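/- Let F be a field of characteristic p > 0 containing the finite field F_q, q = p^s, let V = F³ = Fv ⊕ W be a direct sum of G-submodules for a finite subgroup G ⊆ SL(V), with dim_F W = 2, and suppose there is a basis {x, y} of W with respect to which the image of T(G) in GL(W) equals SL(2, F_q) (all matrices with entries in F_q and determinant 1). Then S(V)^G is Gorenstein if and only if for every g ∈ G the matrix of g|_W with respect to {x, y} has all its entries in the subfield F_{q²} of F (or of its algebraic closure); i.e., G|_W ⊆ GL(2, F_{q²}). -/

import Mathlib

noncomputable section
open CategoryTheory Matrix MvPolynomial

universe u

/-- A module `M` over `R` has finite injective dimension iff the Ext functors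
`Ext^i(-, M)` vanish for all sufficiently large `i`. -/
def HasFiniteInjectiveDimension (R : Type u) [CommRing R] (M : ModuleCat.{u} R) : Prop :=
  ∃ n : ℕ, ∀ (N : ModuleCat.{u} R) (i : ℕ), n < i →
    Subsingleton (((Ext R (ModuleCat.{u} R) i).obj (Opposite.op N)).obj M)

/-- A commutative ring is Gorenstein if it is Noetherian and its localization at every
prime ideal has finite injective dimension over itself. -/
def IsGorensteinRing (R : Type u) [CommRing R] : Prop :=
  IsNoetherianRing R ∧ ∀ (P : Ideal R) [P.IsPrime],
    HasFiniteInjectiveDimension (Localization.AtPrime P)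
      (ModuleCat.of (Localization.AtPrime P) (Localization.AtPrime P))

/-- The substitution action of a matrix on polynomials: `X i ↦ ∑ j, M i j • X j`. -/
def polyAct {F : Type u} [CommSemiring F] {m : ℕ} (M : Matrix (Fin m) (Fin m) F) :
    MvPolynomial (Fin m) F →ₐ[F] MvPolynomial (Fin m) F :=
  MvPolynomial.aeval fun i => ∑ j, M i j • MvPolynomial.X j

/-- The subalgebra of polynomials invariant under a set of matrices. -/
def invariantAlg {F : Type u} [CommSemiring F] {m : ℕ} (S : Set (Matrix (Fin m) (Fin m) F)) :
    Subalgebra F (MvPolynomial (Fin m) F) where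
  carrier := {f | ∀ M ∈ S, polyAct M f = f}
  mul_mem' := fun hf hg => fun M hM => by rw [_root_.map_mul, hf M hM, hg M hM]
  add_mem' := fun hf hg => fun M hM => by rw [_root_.map_add, hf M hM, hg M hM]
  algebraMap_mem' := fun r => fun M hM => (polyAct M).commutes r

/-- The invariant ring `S(V)^G` for a subgroup `G` of `SL(m, F)`, where `S(V)` is realised
as the polynomial ring `F[X 0, …, X (m-1)]`. -/
def invariantRing {F : Type u} [Field F] {m : ℕ}
    (G : Subgroup (Matrix.SpecialLinearGroup (Fin m) F)) :
    Subalgebra F (MvPolynomial (Fin m) F) :=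
  invariantAlg {M | ∃ g ∈ G, (g : Matrix (Fin m) (Fin m) F) = M}

/-- A matrix `M` is a transvection if `rank (M - 1) = 1` and `(M - 1)² = 0`. -/
def IsTransvectionMat {F : Type u} [Field F] {m : ℕ} (M : Matrix (Fin m) (Fin m) F) : Prop :=
  (M - 1).rank = 1 ∧ (M - 1) * (M - 1) = 0

/-- `T(G)`: the subgroup generated by all transvections contained in `G`. -/
def transSubgroup {F : Type u} [Field F] {m : ℕ}
    (G : Subgroup (Matrix.SpecialLinearGroup (Fin m) F)) :
    Subgroup (Matrix.SpecialLinearGroup (Fin m) F) :=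
  Subgroup.closure {g | g ∈ G ∧ IsTransvectionMat (g : Matrix (Fin m) (Fin m) F)}

/-- The matrix of the restriction `g|W` of `g` to the coordinate plane
`W = span {e 1, e 2}` (with respect to the standard basis `{e 1, e 2}` of `W`). -/
def subW {F : Type u} [Field F] (g : Matrix.SpecialLinearGroup (Fin 3) F) :
    Matrix (Fin 2) (Fin 2) F :=
  Matrix.submatrix (g : Matrix (Fin 3) (Fin 3) F) Fin.succ Fin.succ

/-- The matrix of `g|W` with respect to the basis of `W = span {e 1, e 2}` encoded by the
invertible change-of-basis matrix `P`. -/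
def restrictW {F : Type u} [Field F] (P : (Matrix (Fin 2) (Fin 2) F)ˣ)
    (g : Matrix.SpecialLinearGroup (Fin 3) F) : Matrix (Fin 2) (Fin 2) F :=
  (↑P⁻¹ : Matrix (Fin 2) (Fin 2) F) * subW g * (↑P : Matrix (Fin 2) (Fin 2) F)

lemma subsingleton_ext_succ_iff {R : Type u} [CommRing R] (N M : ModuleCat.{u} R) (i : ℕ) :
    Subsingleton (((Ext R (ModuleCat.{u} R) (i + 1)).obj (Opposite.op N)).obj M) ↔
      Subsingleton (Abelian.Ext N M (i + 1)) := by
  let Q := projectiveResolution N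
  rw [← ModuleCat.isZero_iff_subsingleton, (Q.isoExt (R := R) (i + 1) M).isZero_iff,
    ← HomologicalComplex.exactAt_iff_isZero_homology,
    HomologicalComplex.exactAt_iff' _ i (i + 1) (i + 2) (by simp) (by simp),
    ShortComplex.moduleCat_exact_iff]
  constructor
  · intro h
    refine subsingleton_of_forall_eq 0 fun x => ?_
    obtain ⟨f, hf, rfl⟩ := Q.extMk_surjective x (i + 2) rfl
    rw [Q.extMk_eq_zero_iff f (i + 2) rfl hf i rfl]
    exact h f hf
  · intro h f hf
    exact (Q.extMk_eq_zero_iff f (i + 2) rfl hf i rfl).1 (Subsingleton.elim _ _)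

lemma hasFiniteInjectiveDimension_iff {R : Type u} [CommRing R] (M : ModuleCat.{u} R) :
    HasFiniteInjectiveDimension R M ↔ ∃ n : ℕ, HasInjectiveDimensionLE M n := by
  constructor
  · rintro ⟨n, h⟩
    refine ⟨n, hasInjectiveDimensionLT_of_enoughProjectives M (n + 1) fun Y => ?_⟩
    exact (subsingleton_ext_succ_iff Y M n).1 (h Y (n + 1) n.lt_succ_self)
  · rintro ⟨n, h⟩
    refine ⟨n, fun N i hi => ?_⟩
    obtain ⟨j, rfl⟩ : ∃ j, i = j + 1 := ⟨i - 1, by omega⟩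
    rw [subsingleton_ext_succ_iff]
    exact HasInjectiveDimensionLT.subsingleton M (n + 1) (j + 1) (by omega) N

lemma isGorensteinRing_of_hasInjectiveDimensionLE {R : Type u} [CommRing R] [IsNoetherianRing R]
    (n : ℕ) (h : HasInjectiveDimensionLE (ModuleCat.of R R) n) : IsGorensteinRing R := by
  refine ⟨inferInstance, fun P _ => (hasFiniteInjectiveDimension_iff _).2 ⟨n, ?_⟩⟩
  let M := ModuleCat.of R R
  have : IsLocalizedModule P.primeCompl (M.localizedModuleMkLinearMap P.primeCompl) :=
    M.localizedModule_isLocalizedModule P.primeCompl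
  have := M.localizedModule_hasInjectiveDimensionLE n P.primeCompl
  refine (ModuleCat.hasInjectiveDimensionLE_iff_of_linearEquiv ?_ n).1 this
  exact LinearEquiv.extendScalarsOfIsLocalization P.primeCompl
        (Localization.AtPrime P) (IsLocalizedModule.linearEquiv P.primeCompl
        (M.localizedModuleMkLinearMap P.primeCompl)
        (Algebra.linearMap R (Localization.AtPrime P)))

lemma IsGorensteinRing.of_ringEquiv {R R' : Type u} [CommRing R] [CommRing R'] (e : R ≃+* R')
    (h : IsGorensteinRing R) : IsGorensteinRing R' := by
  have := h.1
  refine ⟨isNoetherianRing_of_ringEquiv R e, fun P' _ => ?_⟩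
  obtain ⟨n, hn⟩ := (hasFiniteInjectiveDimension_iff _).1 (h.2 (P'.comap e))
  refine (hasFiniteInjectiveDimension_iff _).2 ⟨n, ?_⟩
  have H : (P'.comap e).primeCompl.map (e : R ≃* R') = P'.primeCompl := by
    ext x
    constructor
    · rintro ⟨y, hy, rfl⟩
      exact hy
    · intro hx
      exact ⟨e.symm x, by simpa [Ideal.primeCompl] using hx, by simp⟩
  let eL : Localization.AtPrime (P'.comap e) ≃+* Localization.AtPrime P' :=
    IsLocalization.ringEquivOfRingEquiv _ _ e H
  let := RingHomInvPair.of_ringEquiv eL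
  let := RingHomInvPair.of_ringEquiv eL.symm
  let eM : ModuleCat.of (Localization.AtPrime (P'.comap e)) (Localization.AtPrime (P'.comap e))
      ≃ₛₗ[RingHomClass.toRingHom eL]
      ModuleCat.of (Localization.AtPrime P') (Localization.AtPrime P') :=
    { eL with map_smul' := fun r x => eL.map_mul r x }
  exact (ModuleCat.hasInjectiveDimensionLE_iff_of_semiLinearEquiv eL eM n).1 hn

section GlobalDimension

/-- Every module over `A` has projective dimension at most `n`. -/
def GlobalDimensionLE (A : Type u) [CommRing A] (n : ℕ) : Prop :=
  ∀ (N : Type u) [AddCommGroup N] [Module A N], HasProjectiveDimensionLE (ModuleCat.of A N) n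

lemma globalDimensionLE_of_field (k : Type u) [Field k] : GlobalDimensionLE k 0 := by
  intro N _ _
  have : Projective (ModuleCat.of k N) :=
    (IsProjective.iff_projective N).1 inferInstance
  exact (projective_iff_hasProjectiveDimensionLT_one).1 this

lemma GlobalDimensionLE.of_ringEquiv {A B : Type u} [CommRing A] [CommRing B] (e : A ≃+* B)
    {n : ℕ} (h : GlobalDimensionLE A n) : GlobalDimensionLE B n := by
  intro N _ _
  let inst : Module A N := Module.compHom N e.toRingHom
  let := RingHomInvPair.of_ringEquiv e
  let := RingHomInvPair.of_ringEquiv e.symm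
  have := h N
  let eN : ModuleCat.of A N ≃ₛₗ[RingHomClass.toRingHom e] ModuleCat.of B N :=
    { AddEquiv.refl N with map_smul' := fun r x => rfl }
  exact ModuleCat.hasProjectiveDimensionLE_of_semiLinearEquiv e eN n

/-- The short complex attached to an exact pair of linear maps. -/
lemma shortExact_of_exact {A : Type u} [CommRing A] {K M N : Type u} [AddCommGroup K]
    [AddCommGroup M] [AddCommGroup N] [Module A K] [Module A M] [Module A N]
    {f : K →ₗ[A] M} {g : M →ₗ[A] N} (hf : Function.Injective f) (hfg : Function.Exact f g)
    (hg : Function.Surjective g) :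
    (ModuleCat.shortComplexOfCompEqZero f g hfg.linearMap_comp_eq_zero).ShortExact :=
  ModuleCat.shortComplex_shortExact _ hfg hf hg

lemma hasProjectiveDimensionLE_baseChange {A B : Type u} [CommRing A] [CommRing B] [Algebra A B]
    [Module.Flat A B] {M : Type u} [AddCommGroup M] [Module A M] (n : ℕ)
    (h : HasProjectiveDimensionLE (ModuleCat.of A M) n) :
    HasProjectiveDimensionLE (ModuleCat.of B (TensorProduct A B M)) n := by
  induction n generalizing M with
  | zero =>
    have h1 := (projective_iff_hasProjectiveDimensionLT_one).2 h
    have : Module.Projective A M := (IsProjective.iff_projective M).2 h1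
    exact (projective_iff_hasProjectiveDimensionLT_one).1
      ((IsProjective.iff_projective _).1 (inferInstance : Module.Projective B (TensorProduct A B M)))
  | succ n ih =>
    let g : (M →₀ A) →ₗ[A] M := Finsupp.linearCombination A id
    have hg : Function.Surjective g := Finsupp.linearCombination_id_surjective A M
    let f : g.ker →ₗ[A] (M →₀ A) := g.ker.subtype
    have hf : Function.Injective f := Subtype.val_injective
    have hfg : Function.Exact f g := LinearMap.exact_subtype_ker_map g
    have hp : Projective (ModuleCat.of A (M →₀ A)) :=
      (IsProjective.iff_projective _).1 inferInstance
    have hp' : Projective (ModuleCat.of B (TensorProduct A B (M →₀ A))) :=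
      (IsProjective.iff_projective _).1 inferInstance
    have hs0 := shortExact_of_exact (K := g.ker) hf hfg hg
    have h1 := (hs0.hasProjectiveDimensionLT_X₃_iff n hp).1 h
    have hs := shortExact_of_exact (f := f.baseChange B) (g := g.baseChange B)
      (Module.Flat.lTensor_preserves_injective_linearMap f hf)
      (lTensor_exact (M := g.ker) B hfg hg) (LinearMap.lTensor_surjective B hg)
    exact (hs.hasProjectiveDimensionLT_X₃_iff n hp').2 (ih h1)

open Polynomial TensorProduct in
lemma GlobalDimensionLE.polynomial {A : Type u} [CommRing A] {n : ℕ}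
    (h : GlobalDimensionLE A n) : GlobalDimensionLE A[X] (n + 1) := by
  intro N _ _
  let inst : Module A N := Module.compHom N (Polynomial.C : A →+* A[X])
  have tower : IsScalarTower A A[X] N := ⟨fun a p x => by
    rw [Polynomial.smul_eq_C_mul, mul_smul]; rfl⟩
  let x : N →ₗ[A] N := LinearMap.lsmul A[X] N (Polynomial.X : A[X]) |>.restrictScalars A
  let α : A[X] ⊗[A] N →ₗ[A[X]] A[X] ⊗[A] N := (Polynomial.X : A[X]) • LinearMap.id - x.baseChange A[X]
  let π : A[X] ⊗[A] N →ₗ[A[X]] N := LinearMap.liftBaseChange A[X] LinearMap.id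
  have hα (p : A[X]) (m : N) : α (p ⊗ₜ m) = (Polynomial.X * p) ⊗ₜ m - p ⊗ₜ ((Polynomial.X : A[X]) • m) := by
    simp [α, x, TensorProduct.smul_tmul']
  have hπ (p : A[X]) (m : N) : π (p ⊗ₜ m) = p • m := by simp [π]
  let c (i : ℕ) : A[X] ⊗[A] N →ₗ[A] N :=
    TensorProduct.lift ((LinearMap.lsmul A N).comp (Polynomial.lcoeff A i))
  have hc (i : ℕ) (p : A[X]) (m : N) : c i (p ⊗ₜ m) = p.coeff i • m := by simp [c]
  have hsum (z : A[X] ⊗[A] N) : ∃ d, ∀ e, d ≤ e →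
      z = ∑ i ∈ Finset.range e, (Polynomial.X ^ i : A[X]) ⊗ₜ c i z := by
    induction z with
    | zero => exact ⟨0, fun e _ => by simp⟩
    | add y z hy hz =>
      obtain ⟨d, hd⟩ := hy
      obtain ⟨d', hd'⟩ := hz
      refine ⟨max d d', fun e he => ?_⟩
      simp only [map_add, TensorProduct.tmul_add, Finset.sum_add_distrib]
      rw [← hd e (by omega), ← hd' e (by omega)]
    | tmul p m =>
      refine ⟨p.natDegree + 1, fun e he => ?_⟩
      conv_lhs => rw [p.as_sum_range' e (by omega)]
      rw [TensorProduct.sum_tmul]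
      refine Finset.sum_congr rfl fun i _ => ?_
      rw [hc, ← TensorProduct.smul_tmul, Polynomial.smul_X_eq_monomial]
  have hcα (i : ℕ) (z : A[X] ⊗[A] N) : c (i + 1) (α z) = c i z - x (c (i + 1) z) := by
    induction z with
    | zero => simp
    | add y z hy hz => simp only [map_add, hy, hz]; abel
    | tmul p m =>
      rw [hα, map_sub, hc, hc, hc, hc, mul_comm, Polynomial.coeff_mul_X]
      simp [x]
  have hαinj : Function.Injective α := by
    rw [injective_iff_map_eq_zero]
    intro z hz
    obtain ⟨d, hd⟩ := hsum z
    have hbig (i : ℕ) (hi : d ≤ i) : c i z = 0 := by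
      have h1 := congrArg (c i) (hd i hi)
      rw [h1, map_sum]
      refine Finset.sum_eq_zero fun j hj => ?_
      rw [hc, Polynomial.coeff_X_pow, if_neg (by simp at hj; omega), zero_smul]
    have hall (j i : ℕ) (hi : d ≤ i + j) : c i z = 0 := by
      induction j generalizing i with
      | zero => exact hbig i hi
      | succ j ih =>
        have h1 := hcα i z
        rw [hz, map_zero, ih (i + 1) (by omega), map_zero, sub_zero] at h1
        exact h1.symm
    rw [hd d le_rfl]
    exact Finset.sum_eq_zero fun i _ => by rw [hall d i (by omega), TensorProduct.tmul_zero]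
  have hmon (i : ℕ) (m : N) :
      (Polynomial.X ^ i : A[X]) ⊗ₜ[A] m - 1 ⊗ₜ ((Polynomial.X ^ i : A[X]) • m) ∈ α.range := by
    induction i generalizing m with
    | zero => simp
    | succ i ih =>
      have h1 := α.range.add_mem (LinearMap.mem_range_self α ((Polynomial.X ^ i : A[X]) ⊗ₜ m))
        (ih ((Polynomial.X : A[X]) • m))
      rw [hα, smul_smul, ← pow_succ, ← pow_succ', sub_add_sub_cancel] at h1
      exact h1
  have hker (z : A[X] ⊗[A] N) : z - 1 ⊗ₜ (π z) ∈ α.range := by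
    obtain ⟨d, hd⟩ := hsum z
    rw [hd d le_rfl, map_sum, TensorProduct.tmul_sum, ← Finset.sum_sub_distrib]
    refine Submodule.sum_mem _ fun i _ => ?_
    rw [hπ]
    exact hmon i _
  have hexact : Function.Exact α π := by
    intro z
    constructor
    · intro hz
      have := hker z
      rwa [hz, TensorProduct.tmul_zero, sub_zero] at this
    · rintro ⟨y, rfl⟩
      induction y with
      | zero => simp
      | add y z hy hz => simp [hy, hz]
      | tmul p m => rw [hα, map_sub, hπ, hπ, smul_smul, mul_comm, sub_self]
  have hsurj : Function.Surjective π := fun m => ⟨1 ⊗ₜ m, by rw [hπ, one_smul]⟩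
  have hP := hasProjectiveDimensionLE_baseChange (B := A[X]) n (h N)
  exact (shortExact_of_exact hαinj hexact hsurj).hasProjectiveDimensionLT_X₃ (n + 1) hP
    (hasProjectiveDimensionLT_of_ge _ (n + 1) (n + 2) (by omega))

lemma globalDimensionLE_mvPolynomial (k : Type u) [Field k] (n : ℕ) :
    GlobalDimensionLE (MvPolynomial (Fin n) k) n := by
  induction n with
  | zero =>
    exact (globalDimensionLE_of_field k).of_ringEquiv
      (MvPolynomial.isEmptyAlgEquiv k (Fin 0)).symm.toRingEquiv
  | succ n ih =>
    exact ih.polynomial.of_ringEquiv (MvPolynomial.finSuccEquiv k n).symm.toRingEquiv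

end GlobalDimension

section Frobenius

variable {A R : Type u} [CommRing A] [CommRing R] [Algebra A R]

/-- Linear maps into a Frobenius extension `R` of `A` extend as soon as their composition with
the Frobenius form extends over `A`. -/
lemma exists_linearMap_of_frobenius {φ : R →ₗ[A] A} {ι : Type*} [Fintype ι] {b b' : ι → R}
    (h : ∀ r, r = ∑ i, φ (b' i * r) • b i) {N : Type*} [AddCommGroup N] [Module R N] [Module A N]
    [IsScalarTower A R N] (g : N →ₗ[A] A) : ∃ g' : N →ₗ[R] R, ∀ y, φ (g' y) = g y := by
  have hzero (x : R) (hx : ∀ s, φ (s * x) = 0) : x = 0 := by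
    rw [h x]; simp [hx]
  have hdual (r : R) : r = ∑ i, φ (r * b i) • b' i := by
    rw [← sub_eq_zero]
    refine hzero _ fun s => ?_
    rw [mul_sub, map_sub, sub_eq_zero, Finset.mul_sum, map_sum]
    conv_lhs => rw [h s, Finset.sum_mul, map_sum]
    refine Finset.sum_congr rfl fun i _ => ?_
    rw [smul_mul_assoc, map_smul, mul_smul_comm, map_smul, smul_eq_mul, smul_eq_mul, mul_comm,
      mul_comm (b i), mul_comm s]
  let e (y : N) : R := ∑ i, g (b' i • y) • b i
  have he (r : R) (y : N) : φ (r * e y) = g (r • y) := by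
    conv_rhs => rw [hdual r, Finset.sum_smul, map_sum]
    rw [Finset.mul_sum, map_sum]
    refine Finset.sum_congr rfl fun i _ => ?_
    rw [mul_smul_comm, map_smul φ, smul_assoc, map_smul g, smul_eq_mul, smul_eq_mul, mul_comm]
  have hext {x y : R} (hxy : ∀ s, φ (s * x) = φ (s * y)) : x = y := by
    rw [← sub_eq_zero]
    exact hzero _ fun s => by rw [mul_sub, map_sub, hxy, sub_self]
  refine ⟨{ toFun := e, map_add' := fun x y => hext fun s => ?_,
            map_smul' := fun r x => hext fun s => ?_ }, fun y => ?_⟩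
  · rw [mul_add, map_add, he, he, he, smul_add, map_add]
  · rw [he, RingHom.id_apply, smul_eq_mul, ← mul_assoc, he, mul_smul]
  · have := he 1 y
    rwa [one_mul, one_smul] at this

lemma subsingleton_ext_of_frobenius {φ : R →ₗ[A] A} {ι : Type*} [Fintype ι] {b b' : ι → R}
    (h : ∀ r, r = ∑ i, φ (b' i * r) • b i) (j : ℕ) {N : Type u} [AddCommGroup N] [Module R N]
    [Module A N] [IsScalarTower A R N] (hN : HasProjectiveDimensionLE (ModuleCat.of A N) j) :
    Subsingleton (Abelian.Ext (ModuleCat.of R N) (ModuleCat.of R R) (j + 1)) := by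
  have hR : Module.Projective A R := by
    let s : R →ₗ[A] (ι → A) := LinearMap.pi fun i => φ.comp (LinearMap.mulLeft A (b' i))
    refine Module.Projective.of_split s (Fintype.linearCombination A b) ?_
    ext r
    rw [LinearMap.comp_apply, Fintype.linearCombination_apply, LinearMap.id_apply]
    exact (h r).symm
  induction j generalizing N with
  | zero =>
    have hNp : Module.Projective A N :=
      (IsProjective.iff_projective N).2 (projective_iff_hasProjectiveDimensionLT_one.2 hN)
    let g : (N →₀ R) →ₗ[R] N := Finsupp.linearCombination R id
    have hg : Function.Surjective g := Finsupp.linearCombination_id_surjective R N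
    obtain ⟨s, hs⟩ := Module.projective_lifting_property (g.restrictScalars A) LinearMap.id hg
    have hgs (x : N) : g (s x) = x := LinearMap.congr_fun hs x
    let ρ : (N →₀ R) →ₗ[A] g.ker := LinearMap.codRestrict (g.ker.restrictScalars A)
      (LinearMap.id - s.comp (g.restrictScalars A)) fun y => by simp [hgs]
    have hρ (y : g.ker) : ρ y = y := by
      apply Subtype.ext
      change (y : N →₀ R) - s (g y) = y
      rw [y.2, map_zero, sub_zero]
    have hS := shortExact_of_exact (K := g.ker) (f := g.ker.subtype) (g := g) Subtype.val_injective
      (LinearMap.exact_subtype_ker_map g) hg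
    have hp : Projective (ModuleCat.of R (N →₀ R)) :=
      (IsProjective.iff_projective _).1 inferInstance
    refine subsingleton_of_forall_eq 0 fun x => ?_
    obtain ⟨y, rfl⟩ := Abelian.Ext.contravariant_sequence_exact₃ hS (ModuleCat.of R R) x
      (@Abelian.Ext.eq_zero_of_projective _ _ _ _ _ _ _ hp _) (add_zero 1)
    obtain ⟨f, rfl⟩ := Abelian.Ext.addEquiv₀.symm.surjective y
    let f' : g.ker →ₗ[R] R := f.hom
    obtain ⟨g', hg'⟩ := exists_linearMap_of_frobenius h
      ((φ.comp (f'.restrictScalars A)).comp ρ)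
    have hfg : f = ModuleCat.ofHom g.ker.subtype ≫ ModuleCat.ofHom g' := by
      ext y
      change f' y = g' (y : N →₀ R)
      have hzero (x : R) (hx : ∀ s, φ (s * x) = 0) : x = 0 := by
        rw [h x]; simp [hx]
      rw [← sub_eq_zero]
      refine hzero _ fun s => ?_
      have h1 := hg' ((s • y : g.ker) : N →₀ R)
      rw [LinearMap.comp_apply, hρ] at h1
      rw [mul_sub, map_sub, sub_eq_zero, ← smul_eq_mul, ← smul_eq_mul, ← map_smul, ← map_smul]
      exact h1.symm
    subst hfg
    rw [Abelian.Ext.addEquiv₀_symm_apply, ← Abelian.Ext.mk₀_comp_mk₀]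
    exact hS.extClass_comp_assoc _
  | succ j ih =>
    let g : (N →₀ R) →ₗ[R] N := Finsupp.linearCombination R id
    have hg : Function.Surjective g := Finsupp.linearCombination_id_surjective R N
    have hS := shortExact_of_exact (K := g.ker) (f := g.ker.subtype) (g := g) Subtype.val_injective
      (LinearMap.exact_subtype_ker_map g) hg
    have hp : Projective (ModuleCat.of R (N →₀ R)) :=
      (IsProjective.iff_projective _).1 inferInstance
    have hpA : Projective (ModuleCat.of A (N →₀ R)) := by
      classical
      exact (IsProjective.iff_projective _).1
        (Module.Projective.of_equiv (finsuppLequivDFinsupp A (ι := N) (M := R)).symm)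
    have hSA := shortExact_of_exact (K := g.ker) (f := g.ker.subtype.restrictScalars A)
      (g := g.restrictScalars A) Subtype.val_injective (LinearMap.exact_subtype_ker_map g) hg
    have hK := ih ((hSA.hasProjectiveDimensionLT_X₃_iff j hpA).1 hN)
    refine subsingleton_of_forall_eq 0 fun x => ?_
    obtain ⟨y, rfl⟩ := Abelian.Ext.contravariant_sequence_exact₃ hS (ModuleCat.of R R) x
      (@Abelian.Ext.eq_zero_of_projective _ _ _ _ _ _ _ hp _) (add_comm 1 (j + 1))
    rw [show y = 0 from hK.elim _ _, Abelian.Ext.comp_zero]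

/-- A Frobenius extension of a ring of finite global dimension has finite self-injective
dimension. -/
theorem hasInjectiveDimensionLE_of_frobenius {d : ℕ} (hA : GlobalDimensionLE A d)
    {φ : R →ₗ[A] A} {ι : Type*} [Fintype ι] {b b' : ι → R}
    (h : ∀ r, r = ∑ i, φ (b' i * r) • b i) :
    HasInjectiveDimensionLE (ModuleCat.of R R) d := by
  refine hasInjectiveDimensionLT_of_enoughProjectives _ (d + 1) fun Y => ?_
  let inst : Module A Y := Module.compHom Y (algebraMap A R)
  have : IsScalarTower A R Y := ⟨fun a r y => by rw [Algebra.smul_def, mul_smul]; rfl⟩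
  exact subsingleton_ext_of_frobenius h d (N := Y) (hA Y)

end Frobenius

section MonomialSubalgebra

/-- The subalgebra of polynomials all of whose monomials have exponents in `M`. -/
def monomialSubalgebra (F : Type u) [Field F] {n : ℕ} (M : AddSubmonoid (Fin n →₀ ℕ)) :
    Subalgebra F (MvPolynomial (Fin n) F) where
  carrier := {f | ∀ m ∈ f.support, m ∈ M}
  mul_mem' := fun {f g} hf hg m hm => by
    classical
    obtain ⟨a, ha, b, hb, rfl⟩ := Finset.mem_add.1 (MvPolynomial.support_mul f g hm)
    exact M.add_mem (hf a ha) (hg b hb)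
  add_mem' := fun {f g} hf hg m hm => by
    classical
    rcases Finset.mem_union.1 (MvPolynomial.support_add hm) with h | h
    exacts [hf m h, hg m h]
  algebraMap_mem' := fun r m hm => by
    classical
    rw [MvPolynomial.algebraMap_eq, MvPolynomial.mem_support_iff, MvPolynomial.coeff_C] at hm
    obtain rfl : 0 = m := by by_contra h; simp [h] at hm
    exact M.zero_mem

/-- A submonoid of exponents which is closed under differences and contains `h` times every
exponent. -/
structure IsExponentMonoid {n : ℕ} (M : AddSubmonoid (Fin n →₀ ℕ)) (h : ℕ) : Prop where
  pos : 0 < h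
  of_add : ∀ a b, a ∈ M → a + b ∈ M → b ∈ M
  single_mem : ∀ j, Finsupp.single j h ∈ M

variable {F : Type u} [Field F] {n : ℕ} {M : AddSubmonoid (Fin n →₀ ℕ)} {h : ℕ}

lemma mem_monomialSubalgebra {f : MvPolynomial (Fin n) F} :
    f ∈ monomialSubalgebra F M ↔ ∀ m, f.coeff m ≠ 0 → m ∈ M :=
  forall_congr' fun m => by rw [MvPolynomial.mem_support_iff]

lemma monomial_mem_monomialSubalgebra {m : Fin n →₀ ℕ} (hm : m ∈ M) (c : F) :
    monomial m c ∈ monomialSubalgebra F M := by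
  classical
  rw [mem_monomialSubalgebra]
  intro a ha
  rw [coeff_monomial] at ha
  obtain rfl : m = a := by by_contra h; simp [h] at ha
  exact hm

lemma IsExponentMonoid.smul_mem (hM : IsExponentMonoid M h) (t : Fin n →₀ ℕ) : h • t ∈ M := by
  induction t using Finsupp.induction_linear with
  | zero => simp
  | add a b ha hb => rw [smul_add]; exact M.add_mem ha hb
  | single j a =>
    rw [Finsupp.smul_single, smul_eq_mul, mul_comm, ← smul_eq_mul, ← Finsupp.smul_single]
    exact M.nsmul_mem (hM.single_mem j) a

/-- Componentwise remainder of an exponent modulo `h`. -/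
def expMod (h : ℕ) (m : Fin n →₀ ℕ) : Fin n →₀ ℕ := m.mapRange (· % h) (Nat.zero_mod h)

/-- Componentwise quotient of an exponent by `h`. -/
def expDiv (h : ℕ) (m : Fin n →₀ ℕ) : Fin n →₀ ℕ := m.mapRange (· / h) (Nat.zero_div h)

@[simp] lemma expMod_apply (m : Fin n →₀ ℕ) (j : Fin n) : expMod h m j = m j % h := rfl

@[simp] lemma expDiv_apply (m : Fin n →₀ ℕ) (j : Fin n) : expDiv h m j = m j / h := rfl

lemma expMod_add_expDiv (m : Fin n →₀ ℕ) : expMod h m + h • expDiv h m = m := by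
  ext j
  simp [Nat.mod_add_div]

lemma IsExponentMonoid.expMod_mem_iff (hM : IsExponentMonoid M h) {m : Fin n →₀ ℕ} :
    expMod h m ∈ M ↔ m ∈ M := by
  conv_rhs => rw [← expMod_add_expDiv (h := h) m]
  refine ⟨fun hm => M.add_mem hm (hM.smul_mem _), fun hm => ?_⟩
  rw [add_comm] at hm
  exact hM.of_add _ _ (hM.smul_mem _) hm

/-- The part of a polynomial with exponents congruent to `i` modulo `h`, divided by `X ^ i` and
written in terms of the `h`-th powers of the variables. -/
def sectionPart (F : Type u) [Field F] (h : ℕ) (i : Fin n →₀ ℕ) :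
    MvPolynomial (Fin n) F →ₗ[F] MvPolynomial (Fin n) F :=
  open Classical in
  (basisMonomials (Fin n) F).constr F fun m =>
    if expMod h m = i then monomial (expDiv h m) 1 else 0

open Classical in
lemma sectionPart_monomial (i m : Fin n →₀ ℕ) (c : F) :
    sectionPart F h i (monomial m c) = if expMod h m = i then monomial (expDiv h m) c else 0 := by
  have h1 : (monomial m c : MvPolynomial (Fin n) F) = c • basisMonomials (Fin n) F m := by
    rw [coe_basisMonomials, smul_monomial, smul_eq_mul, mul_one]
  rw [h1, map_smul, sectionPart, Module.Basis.constr_basis]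
  split_ifs
  · rw [smul_monomial, smul_eq_mul, mul_one]
  · rw [smul_zero]

lemma sectionPart_expand_mul (hh : 0 < h) (i : Fin n →₀ ℕ) (g f : MvPolynomial (Fin n) F) :
    sectionPart F h i (expand h g * f) = g * sectionPart F h i f := by
  induction g using MvPolynomial.induction_on' with
  | add a b ha hb => rw [map_add, add_mul, map_add, ha, hb, add_mul]
  | monomial t a =>
    induction f using MvPolynomial.induction_on' with
    | add p q hp hq => rw [mul_add, map_add, hp, hq, map_add, mul_add]
    | monomial m c =>
      have h1 : expMod h (h • t + m) = expMod h m := by ext j; simp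
      have h2 : expDiv h (h • t + m) = t + expDiv h m := by
        ext j; simp [Nat.mul_add_div hh]
      rw [expand_monomial, monomial_mul, sectionPart_monomial, sectionPart_monomial, h1, h2]
      split_ifs
      · rw [monomial_mul]
      · rw [mul_zero]

lemma sectionPart_monomial_mul {i t : Fin n →₀ ℕ} (hi : ∀ j, i j < h) (ht : ∀ j, t j < h)
    (hit : i ≤ t) (f : MvPolynomial (Fin n) F) :
    sectionPart F h t (monomial (t - i) 1 * f) = sectionPart F h i f := by
  induction f using MvPolynomial.induction_on' with
  | add p q hp hq => rw [mul_add, map_add, hp, hq, map_add]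
  | monomial m c =>
    rw [monomial_mul, one_mul, sectionPart_monomial, sectionPart_monomial]
    by_cases hm : expMod h m = i
    · have h1 (j : Fin n) : m j % h = i j := DFunLike.congr_fun hm j
      have h2 (j : Fin n) : (t - i + m) j = t j + h * (m j / h) := by
        have := Nat.mod_add_div (m j) h
        have := hit j
        rw [Finsupp.add_apply, Finsupp.tsub_apply]
        have := h1 j
        omega
      have h3 : expMod h (t - i + m) = t := by
        ext j
        rw [expMod_apply, h2, Nat.add_mul_mod_self_left, Nat.mod_eq_of_lt (ht j)]
      have h4 : expDiv h (t - i + m) = expDiv h m := by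
        ext j
        rw [expDiv_apply, h2, Nat.add_mul_div_left _ _ (Nat.zero_lt_of_lt (ht j)),
          Nat.div_eq_of_lt (ht j), zero_add, expDiv_apply]
      rw [if_pos h3, if_pos hm, h4]
    · rw [if_neg hm, if_neg]
      intro h3
      apply hm
      ext j
      have h4 : (t j - i j + m j) % h = t j := by
        have := DFunLike.congr_fun h3 j
        simpa using this
      have h5 : (t j - i j + m j) ≡ t j - i j + i j [MOD h] := by
        rw [Nat.sub_add_cancel (hit j), Nat.ModEq, h4, Nat.mod_eq_of_lt (ht j)]
      have h6 : m j ≡ i j [MOD h] := Nat.ModEq.add_left_cancel' _ h5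
      rw [expMod_apply, h6, Nat.mod_eq_of_lt (hi j)]

/-- The exponents with all components smaller than `h`. -/
def boxExp (i : Fin n → Fin h) : Fin n →₀ ℕ := Finsupp.equivFunOnFinite.symm fun j => (i j : ℕ)

@[simp] lemma boxExp_apply (i : Fin n → Fin h) (j : Fin n) : boxExp i j = i j := rfl

noncomputable instance : Fintype {i : Fin n → Fin h // boxExp i ∈ M} := Fintype.ofFinite _

lemma eq_sum_sectionPart (hM : IsExponentMonoid M h) {f : MvPolynomial (Fin n) F}
    (hf : f ∈ monomialSubalgebra F M) :
    f = ∑ i : {i : Fin n → Fin h // boxExp i ∈ M},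
      expand h (sectionPart F h (boxExp i.1) f) * monomial (boxExp i.1) 1 := by
  classical
  suffices H : ∀ m, m ∈ M → ∀ c : F, monomial m c = ∑ i : {i : Fin n → Fin h // boxExp i ∈ M},
      expand h (sectionPart F h (boxExp i.1) (monomial m c)) * monomial (boxExp i.1) 1 by
    conv_lhs => rw [f.as_sum]
    rw [Finset.sum_congr rfl fun m hm => H m (hf m hm) _, Finset.sum_comm]
    refine Finset.sum_congr rfl fun i _ => ?_
    conv_rhs => rw [f.as_sum, map_sum, map_sum, Finset.sum_mul]
  intro m hm c
  let i₀ : Fin n → Fin h := fun j => ⟨m j % h, Nat.mod_lt _ hM.pos⟩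
  have hi₀ : boxExp i₀ = expMod h m := by ext j; rfl
  rw [Finset.sum_eq_single ⟨i₀, by rw [hi₀]; exact hM.expMod_mem_iff.2 hm⟩]
  · rw [sectionPart_monomial, hi₀, if_pos rfl, expand_monomial, monomial_mul, add_comm,
      expMod_add_expDiv, mul_one]
  · intro i _ hi
    rw [sectionPart_monomial, if_neg, map_zero, zero_mul]
    intro h1
    refine hi (Subtype.ext (funext fun j => Fin.ext ?_))
    exact (DFunLike.congr_fun h1 j).symm
  · simp

lemma expand_mem (hM : IsExponentMonoid M h) (f : MvPolynomial (Fin n) F) :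
    expand h f ∈ monomialSubalgebra F M := by
  rw [f.as_sum, map_sum]
  refine Subalgebra.sum_mem _ fun m _ => ?_
  rw [expand_monomial]
  exact monomial_mem_monomialSubalgebra (hM.smul_mem _) _

/-- The structure map of `monomialSubalgebra F M` as an algebra over the polynomial ring in the
`h`-th powers of the variables. -/
def expandHom (F : Type u) [Field F] (hM : IsExponentMonoid M h) :
    MvPolynomial (Fin n) F →+* monomialSubalgebra F M :=
  ((expand h).codRestrict (monomialSubalgebra F M) (expand_mem hM)).toRingHom

lemma isNoetherianRing_monomialSubalgebra (hM : IsExponentMonoid M h) :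
    IsNoetherianRing (monomialSubalgebra F M) := by
  let := (expandHom F hM).toAlgebra
  have : Module.Finite (MvPolynomial (Fin n) F) (monomialSubalgebra F M) := by
    let b (i : {i : Fin n → Fin h // boxExp i ∈ M}) : monomialSubalgebra F M :=
      ⟨monomial (boxExp i.1) 1, monomial_mem_monomialSubalgebra i.2 1⟩
    refine Module.Finite.of_surjective
      (Fintype.linearCombination (MvPolynomial (Fin n) F) b) fun f => ?_
    refine ⟨fun i => sectionPart F h (boxExp i.1) f, ?_⟩
    rw [Fintype.linearCombination_apply]
    apply Subtype.ext
    conv_rhs => rw [eq_sum_sectionPart hM f.2]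
    rw [AddSubmonoidClass.coe_finsetSum]
    rfl
  exact IsNoetherianRing.of_finite (MvPolynomial (Fin n) F) _

/-- If the exponent monoid contains `(1, …, 1)`, the monomial subalgebra is Gorenstein. -/
theorem isGorensteinRing_monomialSubalgebra (hM : IsExponentMonoid M h)
    (hone : Finsupp.equivFunOnFinite.symm (fun _ => 1) ∈ M) :
    IsGorensteinRing (monomialSubalgebra F M) := by
  have := isNoetherianRing_monomialSubalgebra (F := F) hM
  let := (expandHom F hM).toAlgebra
  have hpos := hM.pos
  let t : Fin n →₀ ℕ := Finsupp.equivFunOnFinite.symm fun _ => h - 1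
  have ht (j : Fin n) : t j = h - 1 := rfl
  have htM : t ∈ M := by
    have h1 := M.nsmul_mem hone (h - 1)
    convert h1
    ext j
    simp [ht]
  have hle (i : Fin n → Fin h) : boxExp i ≤ t := fun j => by
    rw [boxExp_apply, ht]; omega
  let φ : monomialSubalgebra F M →ₗ[MvPolynomial (Fin n) F] MvPolynomial (Fin n) F :=
    { toFun := fun f => sectionPart F h t f
      map_add' := fun f g => map_add _ _ _
      map_smul' := fun g f => sectionPart_expand_mul hpos t g f }
  let b (i : {i : Fin n → Fin h // boxExp i ∈ M}) : monomialSubalgebra F M :=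
    ⟨monomial (boxExp i.1) 1, monomial_mem_monomialSubalgebra i.2 1⟩
  let b' (i : {i : Fin n → Fin h // boxExp i ∈ M}) : monomialSubalgebra F M :=
    ⟨monomial (t - boxExp i.1) 1, monomial_mem_monomialSubalgebra
      (hM.of_add _ _ i.2 (by rwa [add_tsub_cancel_of_le (hle _)])) 1⟩
  refine isGorensteinRing_of_hasInjectiveDimensionLE n
    (hasInjectiveDimensionLE_of_frobenius (globalDimensionLE_mvPolynomial F n) (φ := φ)
      (b := b) (b' := b') fun f => ?_)
  apply Subtype.ext
  conv_lhs => rw [eq_sum_sectionPart hM f.2]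
  rw [AddSubmonoidClass.coe_finsetSum]
  refine Finset.sum_congr rfl fun i _ => ?_
  have h1 : φ (b' i * f) = sectionPart F h (boxExp i.1) f :=
    sectionPart_monomial_mul (fun j => (i.1 j).2) (fun j => by rw [ht]; omega) (hle i.1) f.1
  rw [h1]
  rfl

end MonomialSubalgebra

section LocalDuality

open Abelian RingTheory.Sequence

variable {R : Type u} [CommRing R]

lemma smul_ext_eq_zero {K M : ModuleCat.{u} R} {x : R} (hx : ∀ k : K, x • k = 0) {n : ℕ}
    (e : Abelian.Ext K M n) : x • e = 0 := by
  have h1 : x • 𝟙 K = 0 := by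
    ext k
    exact hx k
  rw [← Ext.mk₀_id_comp e, ← Ext.smul_comp, ← Ext.mk₀_smul, h1, Ext.mk₀_zero, Ext.zero_comp]

lemma comp_smulShortComplex_f {K M : ModuleCat.{u} R} (x : R) {n : ℕ} (e : Abelian.Ext K M n) :
    e.comp (Ext.mk₀ (M.smulShortComplex x).f) (add_zero n) = x • e := by
  rw [ModuleCat.smulShortComplex_f_eq_smul_id]
  exact (by rw [Ext.mk₀_smul, Ext.comp_smul, Ext.comp_mk₀_id] :
    e.comp (Ext.mk₀ (x • 𝟙 M)) (add_zero n) = x • e)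

lemma ext_eq_zero_of_isWeaklyRegular (rs : List R) {K M : ModuleCat.{u} R}
    (hK : ∀ r ∈ rs, ∀ k : K, r • k = 0) (hM : IsWeaklyRegular M rs) {i : ℕ} (hi : i < rs.length)
    (e : Abelian.Ext K M i) : e = 0 := by
  induction rs generalizing M i with
  | nil => simp at hi
  | cons x rs ih =>
    rw [isWeaklyRegular_cons_iff] at hM
    have hS := hM.1.smulShortComplex_shortExact
    have he : e.comp (Ext.mk₀ (M.smulShortComplex x).f) (add_zero i) = 0 :=
      (comp_smulShortComplex_f x e).trans (smul_ext_eq_zero (hK x (by simp)) e)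
    cases i with
    | zero =>
      have := hS.mono_f
      exact Ext.postcomp_mk₀_injective_of_mono K (M.smulShortComplex x).f
        (he.trans (map_zero ((Ext.mk₀ (M.smulShortComplex x).f).postcomp K (add_zero 0))).symm)
    | succ i =>
      obtain ⟨e', rfl⟩ := Ext.covariant_sequence_exact₁ K hS e he rfl
      have h1 : e' = 0 := ih (fun r hr => hK r (by simp [hr])) hM.2 (by simpa using hi) e'
      subst h1
      exact Ext.zero_comp K i hS.extClass (i + 1) rfl

lemma exists_comp_eq_of_isWeaklyRegular (rs : List R) {K F M : ModuleCat.{u} R} (i : K ⟶ F)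
    (hK : ∀ r ∈ rs, ∀ k : K, r • k = 0) (hF : ∀ r ∈ rs, ∀ k : F, r • k = 0)
    (hM : IsWeaklyRegular M rs)
    (hsurj : ∀ e : Abelian.Ext K M rs.length, ∃ e' : Abelian.Ext F M rs.length,
      (Ext.mk₀ i).comp e' (zero_add _) = e)
    (g : K ⟶ ModuleCat.of R (M ⧸ Ideal.ofList rs • (⊤ : Submodule R M))) : ∃ g', i ≫ g' = g := by
  induction rs generalizing M with
  | nil =>
    let E := (Submodule.quotEquivOfEqBot (Ideal.ofList ([] : List R) • (⊤ : Submodule R M))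
      (by rw [Ideal.ofList_nil, Submodule.bot_smul])).toModuleIso
    obtain ⟨e, he⟩ := hsurj (Ext.mk₀ (g ≫ E.hom))
    obtain ⟨e, rfl⟩ := Ext.addEquiv₀.symm.surjective e
    rw [Ext.addEquiv₀_symm_apply, Ext.mk₀_comp_mk₀] at he
    have he' := (Ext.mk₀_bijective _ _).1 he
    refine ⟨e ≫ E.inv, ?_⟩
    rw [← Category.assoc, Iso.comp_inv_eq]
    exact he'
  | cons x rs ih =>
    rw [isWeaklyRegular_cons_iff] at hM
    have hS := hM.1.smulShortComplex_shortExact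
    let E := (Submodule.quotOfListConsSMulTopEquivQuotSMulTopInner M x rs).toModuleIso
    obtain ⟨g', hg'⟩ := ih (M := ModuleCat.of R (QuotSMulTop x M))
      (fun r hr => hK r (by simp [hr])) (fun r hr => hF r (by simp [hr])) hM.2
      (fun e => by
        obtain ⟨e₂, he₂⟩ := hsurj (e.comp hS.extClass rfl)
        obtain ⟨e₃, rfl⟩ := Ext.covariant_sequence_exact₁ F hS e₂
          ((comp_smulShortComplex_f x e₂).trans (smul_ext_eq_zero (hF x (by simp)) e₂)) rfl
        refine ⟨e₃, ?_⟩
        let S := M.smulShortComplex x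
        let e₁ : Abelian.Ext K S.X₃ rs.length := e
        change (Ext.mk₀ i).comp e₃ (zero_add _) = e₁
        change _ = e₁.comp hS.extClass rfl at he₂
        obtain ⟨y, hy⟩ := Ext.covariant_sequence_exact₃ K hS
          ((Ext.mk₀ i).comp e₃ (zero_add _) - e₁) rfl (by
            rw [sub_eq_add_neg, Ext.add_comp, Ext.neg_comp, ← sub_eq_add_neg, sub_eq_zero, ← he₂,
              Ext.comp_assoc]
            all_goals first | rfl | lia)
        have h1 : y = 0 := ext_eq_zero_of_isWeaklyRegular (M := M) (x :: rs) hK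
          (by rw [isWeaklyRegular_cons_iff]; exact hM) (by simp) y
        rw [h1, Ext.zero_comp] at hy
        exact (sub_eq_zero.1 hy.symm))
      (g ≫ E.hom)
    refine ⟨g' ≫ E.inv, ?_⟩
    rw [← Category.assoc, Iso.comp_inv_eq]
    exact hg'

variable [IsLocalRing R]

/-- If some `N` containing the residue field has finite length and vanishing higher
`Ext(N, M)`, then the higher `Ext(-, M)` of all modules of finite length vanish. -/
lemma ext_eq_zero_of_isFiniteLength {M N : ModuleCat.{u} R} {d n : ℕ}
    (hd : HasInjectiveDimensionLE M d) (hN : IsFiniteLength R N)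
    (hext : ∀ i, n < i → ∀ e : Abelian.Ext N M i, e = 0)
    {u : N} (hu : u ≠ 0) (hmu : ∀ r ∈ IsLocalRing.maximalIdeal R, r • u = 0)
    {L : Type u} [AddCommGroup L] [Module R L] (hL : IsFiniteLength R L) {i : ℕ} (hi : n < i)
    (e : Abelian.Ext (ModuleCat.of R L) M i) : e = 0 := by
  suffices H : ∀ t i, n < i → d < i + t → ∀ {L : Type u} [AddCommGroup L] [Module R L],
      IsFiniteLength R L → ∀ e : Abelian.Ext (ModuleCat.of R L) M i, e = 0 from
    H (d + 1) i hi (by omega) hL e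
  intro t
  induction t with
  | zero =>
    intro i hi hdi L _ _ _ e
    exact (HasInjectiveDimensionLT.subsingleton M (d + 1) i (by omega) _).elim _ _
  | succ t ih =>
    intro i hi hdi L _ _ hL e
    induction hL with
    | of_subsingleton =>
      rename_i L' _ _ _
      have h1 : 𝟙 (ModuleCat.of R L') = 0 := by ext; exact Subsingleton.elim _ _
      rw [← Ext.mk₀_id_comp e, h1, Ext.mk₀_zero, Ext.zero_comp]
    | of_simple_quotient hL' ihL =>
      rename_i L _ _ L' hsimple
      have hS := shortExact_of_exact (K := L') (f := L'.subtype) (g := L'.mkQ)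
        Subtype.val_injective (LinearMap.exact_subtype_mkQ L') L'.mkQ_surjective
      obtain ⟨e, rfl⟩ := Ext.contravariant_sequence_exact₂ hS M e (ihL _)
      suffices e = 0 by rw [this, Ext.comp_zero]
      change Abelian.Ext (ModuleCat.of R (L ⧸ L')) M i at e
      obtain ⟨m, hm, ⟨φ⟩⟩ := isSimpleModule_iff_quot_maximal.1 hsimple
      obtain rfl := IsLocalRing.eq_maximalIdeal hm
      let j : (R ⧸ IsLocalRing.maximalIdeal R) →ₗ[R] N :=
        Submodule.liftQ _ (LinearMap.toSpanSingleton R N u) hmu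
      have hj : Function.Injective j := by
        rw [← LinearMap.ker_eq_bot]
        refine Submodule.ker_liftQ_eq_bot _ _ _ fun r hr => ?_
        by_contra hrm
        have hr' : IsUnit r := by simpa using hrm
        exact hu (hr'.smul_eq_zero.1 hr)
      let f : (L ⧸ L') →ₗ[R] N := j ∘ₗ φ.toLinearMap
      have hf : Function.Injective f := hj.comp φ.injective
      have hS' := shortExact_of_exact (f := f) (g := f.range.mkQ) hf
        (LinearMap.exact_map_mkQ_range f) f.range.mkQ_surjective
      obtain ⟨e', rfl⟩ := Ext.contravariant_sequence_exact₁ hS' M e (add_comm 1 i)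
        (ih (i + 1) (by omega) (by omega) (hN.of_surjective f.range.mkQ_surjective) _)
      rw [hext i hi e', Ext.comp_zero]

end LocalDuality

section LocalSocle

open Abelian RingTheory.Sequence

variable {R : Type u} [CommRing R] [IsLocalRing R] [IsNoetherianRing R]

lemma isFiniteLength_quotient_of_maximalIdeal_le_radical {J : Ideal R}
    (hJ : IsLocalRing.maximalIdeal R ≤ J.radical) : IsFiniteLength R (R ⧸ J) := by
  have h1 : Ring.KrullDimLE 0 (R ⧸ J) := by
    refine Ring.KrullDimLE.mk₀ fun P hP => ?_
    have h2 : (P.comap (Ideal.Quotient.mk J)).IsMaximal := by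
      have h3 : J ≤ P.comap (Ideal.Quotient.mk J) := fun x hx => by
        rw [Ideal.mem_comap, Ideal.Quotient.eq_zero_iff_mem.2 hx]
        exact P.zero_mem
      have h4 := hJ.trans ((Ideal.IsPrime.radical_le_iff (Ideal.IsPrime.comap _)).2 h3)
      have h5 := IsLocalRing.le_maximalIdeal (Ideal.IsPrime.comap (Ideal.Quotient.mk J) (K := P)).ne_top
      rw [← le_antisymm h4 h5]
      infer_instance
    have h3 := Ideal.map_comap_of_surjective _ Ideal.Quotient.mk_surjective P
    rw [← h3]
    refine (Ideal.map_eq_top_or_isMaximal_of_surjective _ Ideal.Quotient.mk_surjective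
      h2).resolve_left ?_
    rw [h3]
    exact hP.ne_top
  have h2 : IsArtinianRing (R ⧸ J) :=
    isArtinianRing_iff_isNoetherianRing_krullDimLE_zero.2 ⟨inferInstance, h1⟩
  have h3 : IsArtinian R (R ⧸ J) :=
    isArtinian_of_surjective_algebraMap (Ideal.Quotient.mk_surjective (I := J))
  exact isFiniteLength_iff_isNoetherian_isArtinian.2 ⟨inferInstance, h3⟩

/-- In a local ring of finite self-injective dimension, the socle modulo a system of parameters
forming a regular sequence is generated by any of its nonzero elements. -/
theorem mem_span_sup_ofList_of_socle {d : ℕ} (hd : HasInjectiveDimensionLE (ModuleCat.of R R) d)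
    {rs : List R} (reg : IsRegular R rs)
    (hrad : IsLocalRing.maximalIdeal R ≤ (Ideal.ofList rs).radical) {u w : R}
    (hu : u ∉ Ideal.ofList rs)
    (hmu : ∀ r ∈ IsLocalRing.maximalIdeal R, r * u ∈ Ideal.ofList rs)
    (hmw : ∀ r ∈ IsLocalRing.maximalIdeal R, r * w ∈ Ideal.ofList rs) :
    w ∈ Ideal.span {u} ⊔ Ideal.ofList rs := by
  by_contra hw
  have hunit {r : R} (hr : r ∉ IsLocalRing.maximalIdeal R) : IsUnit r := by simpa using hr
  let J := Ideal.ofList rs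
  have hwJ : w ∉ J := fun h => hw (Ideal.mem_sup_right h)
  let k := R ⧸ IsLocalRing.maximalIdeal R
  let F := R ⧸ J
  have hmk {x : R} : (Submodule.Quotient.mk x : F) = 0 ↔ x ∈ J := Submodule.Quotient.mk_eq_zero J
  let j (x : R) (hx : ∀ r ∈ IsLocalRing.maximalIdeal R, r * x ∈ J) : k →ₗ[R] F :=
    Submodule.liftQ _ (LinearMap.toSpanSingleton R F (Submodule.Quotient.mk x)) fun r hr => by
      rw [LinearMap.mem_ker, LinearMap.toSpanSingleton_apply, ← Submodule.Quotient.mk_smul, hmk]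
      exact hx r hr
  have hj (x : R) (hx) (r : R) : j x hx (Submodule.Quotient.mk r) = Submodule.Quotient.mk (r * x) :=
    rfl
  let f : (k × k) →ₗ[R] F := (j u hmu).coprod (j w hmw)
  have hf : Function.Injective f := by
    rw [injective_iff_map_eq_zero]
    rintro ⟨a, b⟩ hab
    obtain ⟨a, rfl⟩ := Submodule.Quotient.mk_surjective _ a
    obtain ⟨b, rfl⟩ := Submodule.Quotient.mk_surjective _ b
    rw [LinearMap.coprod_apply, hj u hmu, hj w hmw, ← Submodule.Quotient.mk_add, hmk] at hab
    have hb : b ∈ IsLocalRing.maximalIdeal R := by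
      by_contra hb
      apply hw
      rw [← Ideal.unit_mul_mem_iff_mem _ (hunit hb)]
      have h1 : b * w = -a * u + (a * u + b * w) := by ring
      rw [h1]
      exact Ideal.add_mem _ (Ideal.mem_sup_left (Ideal.mul_mem_left _ _
        (Ideal.mem_span_singleton_self u))) (Ideal.mem_sup_right hab)
    have ha : a ∈ IsLocalRing.maximalIdeal R := by
      by_contra ha
      apply hu
      rw [← Ideal.unit_mul_mem_iff_mem _ (hunit ha)]
      exact (Ideal.add_mem_iff_left _ (hmw b hb)).1 hab
    rw [(Submodule.Quotient.mk_eq_zero _).2 ha, (Submodule.Quotient.mk_eq_zero _).2 hb]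
    rfl
  have hkill {L : Type u} [AddCommGroup L] [Module R L] (g : L →ₗ[R] F)
      (hg : Function.Injective g) (r : R) (hr : r ∈ rs) (x : L) : r • x = 0 := by
    apply hg
    rw [map_smul, map_zero]
    obtain ⟨y, hy⟩ := Submodule.Quotient.mk_surjective _ (g x)
    rw [← hy, ← Submodule.Quotient.mk_smul, hmk]
    exact Ideal.mul_mem_right _ _ (Ideal.subset_span hr)
  have hF : IsFiniteLength R F := isFiniteLength_quotient_of_maximalIdeal_le_radical hrad
  have hpd : HasProjectiveDimensionLE (ModuleCat.of R F) rs.length := by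
    rw [← projectiveDimension_le_iff, ← ModuleCat.projectiveDimension_quotient_eq_length.{u} rs reg]
    exact (projectiveDimension_eq_of_iso (Shrink.linearEquiv R F).toModuleIso).ge
  have hS := shortExact_of_exact (f := f) (g := f.range.mkQ) hf
    (LinearMap.exact_map_mkQ_range f) f.range.mkQ_surjective
  have hsurj (e : Abelian.Ext (ModuleCat.of R (k × k)) (ModuleCat.of R R) rs.length) :
      ∃ e' : Abelian.Ext (ModuleCat.of R F) (ModuleCat.of R R) rs.length,
        (Ext.mk₀ (ModuleCat.ofHom f)).comp e' (zero_add _) = e := by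
    refine Ext.contravariant_sequence_exact₁ hS (ModuleCat.of R R) e (add_comm 1 _) ?_
    refine ext_eq_zero_of_isFiniteLength (N := ModuleCat.of R F) (n := rs.length) hd hF
      (fun i hi e => ?_) (u := (Submodule.Quotient.mk u : F)) (fun h => hu (hmk.1 h))
      (fun r hr => ?_) (hF.of_surjective f.range.mkQ_surjective) (Nat.lt_succ_self _) _
    · exact (HasProjectiveDimensionLT.subsingleton _ (rs.length + 1) i hi _).elim _ _
    · rw [← Submodule.Quotient.mk_smul, hmk]
      exact hmu r hr
  have hJ : Ideal.ofList rs • (⊤ : Submodule R R) = J := Ideal.mul_top _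
  let E : (R ⧸ Ideal.ofList rs • (⊤ : Submodule R R)) ≃ₗ[R] F := Submodule.quotEquivOfEq _ _ hJ
  let g : (k × k) →ₗ[R] F := (j u hmu).coprod 0
  obtain ⟨g', hg'⟩ := exists_comp_eq_of_isWeaklyRegular rs (M := ModuleCat.of R R)
    (ModuleCat.ofHom f) (hkill f hf) (hkill LinearMap.id Function.injective_id) reg.1 hsurj
    (ModuleCat.ofHom (E.symm.toLinearMap ∘ₗ g))
  let φ : F →ₗ[R] F := E.toLinearMap ∘ₗ g'.hom
  have hφ (x : k × k) : φ (f x) = g x := by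
    have h1 : g'.hom (f x) = E.symm (g x) :=
      LinearMap.congr_fun (congrArg ModuleCat.Hom.hom hg') x
    change E (g'.hom (f x)) = g x
    rw [h1, LinearEquiv.apply_symm_apply]
  obtain ⟨r, hr⟩ := Submodule.Quotient.mk_surjective _ (φ (Submodule.Quotient.mk 1))
  have hφr (x : R) : φ (Submodule.Quotient.mk x) = Submodule.Quotient.mk (x * r) := by
    have h1 : (Submodule.Quotient.mk x : F) = x • Submodule.Quotient.mk 1 := by
      rw [← Submodule.Quotient.mk_smul, smul_eq_mul, mul_one]
    rw [h1, map_smul, ← hr]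
    rfl
  have h1 := hφ (Submodule.Quotient.mk 1, 0)
  have h2 := hφ (0, Submodule.Quotient.mk 1)
  rw [LinearMap.coprod_apply, LinearMap.coprod_apply, map_zero, hj u hmu, one_mul, add_zero, hφr,
    LinearMap.zero_apply, add_zero, ← sub_eq_zero, ← Submodule.Quotient.mk_sub, hmk] at h1
  rw [LinearMap.coprod_apply, LinearMap.coprod_apply, map_zero, hj w hmw, one_mul, zero_add, hφr,
    LinearMap.zero_apply, add_zero, hmk, mul_comm] at h2
  by_cases hrm : r ∈ IsLocalRing.maximalIdeal R
  · apply hu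
    have h3 := hmu r hrm
    rw [mul_comm] at h3
    simpa using Ideal.sub_mem _ h3 h1
  · exact hwJ ((Ideal.unit_mul_mem_iff_mem _ (hunit hrm)).1 h2)

end LocalSocle

section MonomialSocle

open RingTheory.Sequence

variable {F : Type u} [Field F] {n : ℕ} {M : AddSubmonoid (Fin n →₀ ℕ)} {h : ℕ}

lemma eq_sum_monomial (f : monomialSubalgebra F M) :
    f = ∑ m ∈ f.1.support.attach,
      ⟨monomial m.1 (f.1.coeff m.1), monomial_mem_monomialSubalgebra (f.2 m.1 m.2) _⟩ := by
  apply Subtype.ext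
  rw [AddSubmonoidClass.coe_finsetSum]
  exact ((Finset.sum_attach _ fun m => monomial m (f.1.coeff m)).trans
    f.1.support_sum_monomial_coeff).symm

lemma exists_add_of_coeff_mul_ne_zero {f g : MvPolynomial (Fin n) F} {m : Fin n →₀ ℕ}
    (hm : (f * g).coeff m ≠ 0) : ∃ a b, f.coeff a ≠ 0 ∧ g.coeff b ≠ 0 ∧ a + b = m := by
  classical
  obtain ⟨a, ha, b, hb, hab⟩ := Finset.mem_add.1 (support_mul f g (mem_support_iff.2 hm))
  exact ⟨a, b, mem_support_iff.1 ha, mem_support_iff.1 hb, hab⟩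

/-- The power `X j ^ h` as an element of the subalgebra spanned by monomials in `M`. -/
def varPow (F : Type u) [Field F] (hM : IsExponentMonoid M h) (j : Fin n) :
    monomialSubalgebra F M :=
  ⟨monomial (Finsupp.single j h) 1, monomial_mem_monomialSubalgebra (hM.single_mem j) 1⟩

lemma mem_ofList_varPow (hM : IsExponentMonoid M h) (l : List (Fin n))
    {f : monomialSubalgebra F M} :
    f ∈ Ideal.ofList (l.map (varPow F hM)) ↔ ∀ m, f.1.coeff m ≠ 0 → ∃ j ∈ l, h ≤ m j := by
  classical
  constructor
  · intro hf
    induction hf using Submodule.span_induction with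
    | mem x hx =>
      obtain ⟨j, hj, rfl⟩ := List.mem_map.1 hx
      intro m hm
      refine ⟨j, hj, ?_⟩
      rw [varPow, coeff_monomial] at hm
      obtain rfl : Finsupp.single j h = m := by by_contra h; simp [h] at hm
      simp
    | zero => intro m hm; exact absurd (coeff_zero m) hm
    | add x y _ _ hx hy =>
      intro m hm
      by_cases h1 : x.1.coeff m = 0
      · refine hy m fun h2 => hm ?_
        change (x.1 + y.1).coeff m = 0
        rw [coeff_add, h1, h2, add_zero]
      · exact hx m h1
    | smul r x _ hx =>
      intro m hm
      obtain ⟨a, b, -, hb, rfl⟩ := exists_add_of_coeff_mul_ne_zero (f := r.1) (g := x.1) hm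
      obtain ⟨j, hj, hbj⟩ := hx b hb
      exact ⟨j, hj, hbj.trans (by simp)⟩
  · intro hf
    rw [eq_sum_monomial f]
    refine Ideal.sum_mem _ fun m _ => ?_
    obtain ⟨j, hj, hmj⟩ := hf m.1 (mem_support_iff.1 m.2)
    have h1 : Finsupp.single j h + (m.1 - Finsupp.single j h) = m.1 :=
      add_tsub_cancel_of_le (Finsupp.single_le_iff.2 hmj)
    have h2 : m.1 - Finsupp.single j h ∈ M := by
      refine hM.of_add _ _ (hM.single_mem j) ?_
      rw [h1]
      exact f.2 _ m.2
    have h3 : (⟨monomial m.1 (f.1.coeff m.1), monomial_mem_monomialSubalgebra (f.2 m.1 m.2) _⟩ :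
        monomialSubalgebra F M) = ⟨monomial (m.1 - Finsupp.single j h) (f.1.coeff m.1),
          monomial_mem_monomialSubalgebra h2 _⟩ * varPow F hM j := by
      apply Subtype.ext
      change _ = monomial (m.1 - Finsupp.single j h) (f.1.coeff m.1) *
        monomial (Finsupp.single j h) 1
      rw [monomial_mul, mul_one, add_comm _ (Finsupp.single j h), h1]
    rw [h3]
    exact Ideal.mul_mem_left _ _ (Ideal.subset_span (List.mem_map_of_mem hj))

lemma isWeaklyRegular_varPow (hM : IsExponentMonoid M h) {l : List (Fin n)} (hl : l.Nodup) :
    IsWeaklyRegular (monomialSubalgebra F M) (l.map (varPow F hM)) := by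
  refine ⟨fun i hi => ?_⟩
  have hi' : i < l.length := by simpa using hi
  have hnot : l[i] ∉ l.take i := by
    intro h1
    obtain ⟨k, hk, hk'⟩ := List.mem_take_iff_getElem.1 h1
    have h2 := (List.Nodup.getElem_inj_iff hl).1 hk'
    omega
  rw [List.getElem_map, ← List.map_take, isSMulRegular_iff_right_eq_zero_of_smul]
  intro x hx
  obtain ⟨f, rfl⟩ := Submodule.Quotient.mk_surjective _ x
  rw [← Submodule.Quotient.mk_smul, Submodule.Quotient.mk_eq_zero, smul_eq_mul (b := f),
    Ideal.smul_eq_mul, Ideal.mul_top, mem_ofList_varPow] at hx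
  rw [Submodule.Quotient.mk_eq_zero, Ideal.smul_eq_mul, Ideal.mul_top, mem_ofList_varPow]
  intro m hm
  obtain ⟨j, hj, hmj⟩ := hx (Finsupp.single l[i] h + m) (by
    change (monomial (Finsupp.single l[i] h) 1 * f.1).coeff _ ≠ 0
    rwa [coeff_monomial_mul, one_mul])
  refine ⟨j, hj, ?_⟩
  have hne : l[i] ≠ j := fun h => hnot (h ▸ hj)
  rwa [Finsupp.add_apply, Finsupp.single_eq_of_ne' hne, zero_add] at hmj

/-- The ideal of elements of the monomial subalgebra without constant term. -/
def originIdeal (F : Type u) [Field F] (M : AddSubmonoid (Fin n →₀ ℕ)) :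
    Ideal (monomialSubalgebra F M) :=
  RingHom.ker ((constantCoeff (σ := Fin n) (R := F)).comp (monomialSubalgebra F M).val.toRingHom)

instance : (originIdeal F M).IsPrime := RingHom.ker_isPrime _

lemma mem_originIdeal {f : monomialSubalgebra F M} : f ∈ originIdeal F M ↔ f.1.coeff 0 = 0 :=
  Iff.rfl

lemma originIdeal_le_radical (hM : IsExponentMonoid M h) :
    originIdeal F M ≤ (Ideal.ofList ((List.finRange n).map (varPow F hM))).radical := by
  classical
  intro f hf
  rw [eq_sum_monomial f]
  refine Ideal.sum_mem _ fun m _ => ⟨h, ?_⟩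
  rw [mem_ofList_varPow]
  intro a ha
  change ((monomial m.1 (f.1.coeff m.1)) ^ h).coeff a ≠ 0 at ha
  rw [monomial_pow, coeff_monomial] at ha
  obtain rfl : h • m.1 = a := by by_contra h; simp [h] at ha
  have hm : m.1 ≠ 0 := fun h => mem_support_iff.1 m.2 (h ▸ hf)
  obtain ⟨j, hj⟩ := Finsupp.ne_iff.1 hm
  refine ⟨j, List.mem_finRange j, ?_⟩
  rw [Finsupp.smul_apply, smul_eq_mul]
  exact Nat.le_mul_of_pos_right h (Nat.pos_of_ne_zero hj)

lemma IsGorensteinRing.le_of_socle (hM : IsExponentMonoid M h)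
    (hG : IsGorensteinRing (monomialSubalgebra F M)) {u w : Fin n →₀ ℕ} (hu : u ∈ M)
    (hw : w ∈ M) (hub : ∀ j, u j < h) (hwb : ∀ j, w j < h)
    (humax : ∀ a ∈ M, a ≠ 0 → ∃ j, h ≤ (a + u) j) (hwmax : ∀ a ∈ M, a ≠ 0 → ∃ j, h ≤ (a + w) j) :
    u ≤ w := by
  classical
  let R := monomialSubalgebra F M
  let m := originIdeal F M
  let S := Localization.AtPrime m
  let rs := (List.finRange n).map (varPow F hM)
  have : IsNoetherianRing R := hG.1
  have : IsNoetherianRing S := IsLocalization.isNoetherianRing m.primeCompl S hG.1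
  obtain ⟨d, hd⟩ := (hasFiniteInjectiveDimension_iff _).1 (hG.2 m)
  have hmap : Ideal.ofList (rs.map (algebraMap R S)) = (Ideal.ofList rs).map (algebraMap R S) :=
    (Ideal.map_ofList _ _).symm
  have hmax : IsLocalRing.maximalIdeal S = m.map (algebraMap R S) :=
    (Localization.AtPrime.map_eq_maximalIdeal).symm
  have hreg : IsRegular S (rs.map (algebraMap R S)) := by
    refine (isWeaklyRegular_varPow hM (List.nodup_finRange n)).isRegular_of_isLocalization_of_mem
      S m fun r hr => ?_
    obtain ⟨j, -, rfl⟩ := List.mem_map.1 hr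
    rw [mem_originIdeal, varPow, coeff_monomial, if_neg]
    simpa using hM.pos.ne'
  have hrad : IsLocalRing.maximalIdeal S ≤ (Ideal.ofList (rs.map (algebraMap R S))).radical := by
    rw [hmax, hmap]
    exact (Ideal.map_mono (originIdeal_le_radical hM)).trans (Ideal.map_radical_le _)
  let mon (a : Fin n →₀ ℕ) (ha : a ∈ M) : R := ⟨monomial a 1, monomial_mem_monomialSubalgebra ha 1⟩
  have hsocle (a : Fin n →₀ ℕ) (ha : a ∈ M) (hamax : ∀ b ∈ M, b ≠ 0 → ∃ j, h ≤ (b + a) j) :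
      ∀ r ∈ IsLocalRing.maximalIdeal S,
        r * algebraMap R S (mon a ha) ∈ Ideal.ofList (rs.map (algebraMap R S)) := by
    intro r hr
    rw [hmax] at hr
    induction hr using Submodule.span_induction with
    | mem x hx =>
      obtain ⟨f, hf, rfl⟩ := hx
      rw [← map_mul, hmap]
      refine Ideal.mem_map_of_mem _ ((mem_ofList_varPow hM _).2 fun c hc => ?_)
      obtain ⟨b, a', hb, ha', rfl⟩ := exists_add_of_coeff_mul_ne_zero (f := f.1)
        (g := monomial a 1) hc
      rw [coeff_monomial] at ha'
      obtain rfl : a = a' := by by_contra h; simp [h] at ha'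
      obtain ⟨j, hj⟩ := hamax b (f.2 b (mem_support_iff.2 hb)) (by rintro rfl; exact hb hf)
      exact ⟨j, List.mem_finRange j, hj⟩
    | zero => rw [zero_mul]; exact Ideal.zero_mem _
    | add x y _ _ hx hy => rw [add_mul]; exact Ideal.add_mem _ hx hy
    | smul s x _ hx => rw [smul_eq_mul, mul_assoc]; exact Ideal.mul_mem_left _ _ hx
  have hunit (a : Fin n →₀ ℕ) (ha : a ∈ M) (hab : ∀ j, a j < h) (I : Ideal R)
      (hI : algebraMap R S (mon a ha) ∈ I.map (algebraMap R S)) :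
      ∃ f ∈ I, f.1.coeff a ≠ 0 := by
    obtain ⟨t, ht, htI⟩ := (IsLocalization.algebraMap_mem_map_algebraMap_iff m.primeCompl S I _).1 hI
    refine ⟨_, htI, ?_⟩
    change (t.1 * monomial a 1).coeff a ≠ 0
    have h1 := coeff_mul_monomial 0 a 1 t.1
    rw [zero_add, mul_one] at h1
    rw [h1]
    exact ht
  have hu' : algebraMap R S (mon u hu) ∉ Ideal.ofList (rs.map (algebraMap R S)) := by
    intro h1
    rw [hmap] at h1
    obtain ⟨f, hf, hfu⟩ := hunit u hu hub _ h1
    obtain ⟨j, -, hj⟩ := (mem_ofList_varPow hM _).1 hf u hfu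
    exact absurd (hub j) hj.not_gt
  have key := mem_span_sup_ofList_of_socle hd hreg hrad hu' (hsocle u hu humax) (hsocle w hw hwmax)
  rw [hmap, ← Set.image_singleton, ← Ideal.map_span, ← Ideal.map_sup] at key
  obtain ⟨f, hf, hfw⟩ := hunit w hw hwb _ key
  obtain ⟨g, hg, e, he, rfl⟩ := Submodule.mem_sup.1 hf
  obtain ⟨r, rfl⟩ := Ideal.mem_span_singleton'.1 hg
  have he0 : e.1.coeff w = 0 := by
    by_contra h1
    obtain ⟨j, -, hj⟩ := (mem_ofList_varPow hM _).1 he w h1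
    exact absurd (hwb j) hj.not_gt
  change (r.1 * monomial u 1 + e.1).coeff w ≠ 0 at hfw
  rw [coeff_add, he0, add_zero, coeff_mul_monomial'] at hfw
  by_contra h1
  exact hfw (if_neg h1)

/-- If the monomial subalgebra is Gorenstein and every variable occurs with exponent one in some
monomial, then it contains the product of all variables. -/
theorem IsGorensteinRing.one_mem (hM : IsExponentMonoid M h)
    (hG : IsGorensteinRing (monomialSubalgebra F M)) (hone : ∀ j, ∃ m ∈ M, m j = 1) :
    Finsupp.equivFunOnFinite.symm (fun _ => 1) ∈ M := by
  have hfin : {m : Fin n →₀ ℕ | m ∈ M ∧ ∀ j, m j < h}.Finite :=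
    (Set.finite_Iic (Finsupp.equivFunOnFinite.symm fun _ : Fin n => h)).subset
      fun m hm j => (hm.2 j).le
  have hmax (b) (hb : Maximal (· ∈ {m : Fin n →₀ ℕ | m ∈ M ∧ ∀ j, m j < h}) b) :
      ∀ a ∈ M, a ≠ 0 → ∃ j, h ≤ (a + b) j := by
    intro a ha ha0
    by_contra! h1
    have h2 := hb.2 ⟨M.add_mem ha hb.1.1, h1⟩ le_add_self
    exact ha0 (nonpos_iff_eq_zero.1 ((add_le_iff_nonpos_left).1 h2))
  have hex (j : Fin n) : ∃ b, Maximal (· ∈ {m : Fin n →₀ ℕ | m ∈ M ∧ ∀ j, m j < h}) b ∧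
      b j = h - 1 := by
    obtain ⟨m, hm, hmj⟩ := hone j
    obtain ⟨b, hb, hbmax⟩ := hfin.exists_le_maximal (a := expMod h ((h - 1) • m))
      ⟨hM.expMod_mem_iff.2 (M.nsmul_mem hm _), fun k => Nat.mod_lt _ hM.pos⟩
    refine ⟨b, hbmax, ?_⟩
    have h1 := hb j
    have h2 := hbmax.1.2 j
    have h3 := hM.pos
    rw [expMod_apply, Finsupp.smul_apply, hmj, smul_eq_mul, mul_one,
      Nat.mod_eq_of_lt (by omega)] at h1
    omega
  choose b hb hbj using hex
  have hle (i j : Fin n) : b i ≤ b j :=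
    hG.le_of_socle hM (hb i).1.1 (hb j).1.1 (hb i).1.2 (hb j).1.2 (hmax _ (hb i)) (hmax _ (hb j))
  have htop : Finsupp.equivFunOnFinite.symm (fun _ : Fin n => h - 1) ∈ M := by
    rcases isEmpty_or_nonempty (Fin n) with h0 | ⟨⟨i⟩⟩
    · rw [Subsingleton.elim (Finsupp.equivFunOnFinite.symm (fun _ : Fin n => h - 1)) 0]
      exact M.zero_mem
    · convert (hb i).1.1
      ext j
      rw [le_antisymm (hle i j) (hle j i), hbj]
      rfl
  refine hM.of_add _ _ htop ?_
  convert hM.smul_mem (Finsupp.equivFunOnFinite.symm fun _ : Fin n => 1) using 1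
  ext j
  have := hM.pos
  simp
  omega

end MonomialSocle

section LinearSubstitution

variable {F : Type u} [Field F]

lemma polyAct_X {n : ℕ} (N : Matrix (Fin n) (Fin n) F) (i : Fin n) :
    polyAct N (X i) = ∑ j, N i j • X j := aeval_X _ _

lemma polyAct_comp {n : ℕ} (N N' : Matrix (Fin n) (Fin n) F) :
    (polyAct N).comp (polyAct N') = polyAct (N' * N) := by
  apply MvPolynomial.algHom_ext
  intro i
  rw [AlgHom.comp_apply, polyAct_X, polyAct_X, map_sum]
  simp_rw [map_smul, polyAct_X, Finset.smul_sum, Matrix.mul_apply, Finset.sum_smul, smul_smul]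
  exact Finset.sum_comm

lemma polyAct_polyAct {n : ℕ} (N N' : Matrix (Fin n) (Fin n) F) (f : MvPolynomial (Fin n) F) :
    polyAct N (polyAct N' f) = polyAct (N' * N) f :=
  DFunLike.congr_fun (polyAct_comp N N') f

lemma polyAct_one {n : ℕ} (f : MvPolynomial (Fin n) F) : polyAct 1 f = f := by
  have h : polyAct (1 : Matrix (Fin n) (Fin n) F) = AlgHom.id F _ := by
    apply MvPolynomial.algHom_ext
    intro i
    simp [polyAct_X, Matrix.one_apply]
  rw [h, AlgHom.id_apply]

/-- Substitution by an invertible matrix, as an algebra automorphism. -/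
def polyActEquiv {n : ℕ} (N : (Matrix (Fin n) (Fin n) F)ˣ) :
    MvPolynomial (Fin n) F ≃ₐ[F] MvPolynomial (Fin n) F :=
  AlgEquiv.ofAlgHom (polyAct N.1) (polyAct N⁻¹.1)
    (by ext1 i; rw [AlgHom.comp_apply, polyAct_polyAct, Units.inv_mul, polyAct_one]; rfl)
    (by ext1 i; rw [AlgHom.comp_apply, polyAct_polyAct, Units.mul_inv, polyAct_one]; rfl)

lemma X_dvd_iff_coeff {n : ℕ} {i : Fin n} {f : MvPolynomial (Fin n) F} :
    X i ∣ f ↔ ∀ m, m i = 0 → f.coeff m = 0 := by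
  classical
  rw [X_dvd_iff_modMonomial_eq_zero]
  have hle (m : Fin n →₀ ℕ) : Finsupp.single i 1 ≤ m ↔ m i ≠ 0 := by
    rw [Finsupp.single_le_iff, Nat.one_le_iff_ne_zero]
  constructor
  · intro h m hm
    rw [← coeff_modMonomial_of_not_le (s := Finsupp.single i 1) f
      (by rw [hle]; simpa using hm), h, coeff_zero]
  · intro h
    ext m
    by_cases hm : m i = 0
    · rw [coeff_modMonomial_of_not_le f (by rw [hle]; simpa using hm), h m hm, coeff_zero]
    · rw [coeff_modMonomial_of_le f ((hle m).2 hm), coeff_zero]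

/-- The block diagonal matrix with blocks `d` and `B`. -/
def blockMat (d : F) (B : Matrix (Fin 2) (Fin 2) F) : Matrix (Fin 3) (Fin 3) F :=
  !![d, 0, 0; 0, B 0 0, B 0 1; 0, B 1 0, B 1 1]

lemma polyAct_blockMat (d : F) (B : Matrix (Fin 2) (Fin 2) F) :
    polyAct (blockMat d B) = aeval ![d • X 0, B 0 0 • X 1 + B 0 1 • X 2,
      B 1 0 • X 1 + B 1 1 • X 2] := by
  apply MvPolynomial.algHom_ext
  intro i
  rw [polyAct_X, aeval_X, Fin.sum_univ_three]
  fin_cases i <;> simp [blockMat]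

@[simp] lemma polyAct_blockMat_X_zero (d : F) (B : Matrix (Fin 2) (Fin 2) F) :
    polyAct (blockMat d B) (X 0) = d • X 0 := by rw [polyAct_blockMat, aeval_X]; rfl

@[simp] lemma polyAct_blockMat_X_one (d : F) (B : Matrix (Fin 2) (Fin 2) F) :
    polyAct (blockMat d B) (X 1) = B 0 0 • X 1 + B 0 1 • X 2 := by
  rw [polyAct_blockMat, aeval_X]; rfl

@[simp] lemma polyAct_blockMat_X_two (d : F) (B : Matrix (Fin 2) (Fin 2) F) :
    polyAct (blockMat d B) (X 2) = B 1 0 • X 1 + B 1 1 • X 2 := by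
  rw [polyAct_blockMat, aeval_X]; rfl

lemma blockMat_mul (d d' : F) (B B' : Matrix (Fin 2) (Fin 2) F) :
    blockMat d B * blockMat d' B' = blockMat (d * d') (B * B') := by
  ext i j
  fin_cases i <;> fin_cases j <;>
    simp [blockMat, Matrix.mul_apply, Fin.sum_univ_three, Fin.sum_univ_two]

lemma blockMat_one : blockMat (1 : F) 1 = 1 := by
  ext i j
  fin_cases i <;> fin_cases j <;> simp [blockMat]

/-- A block diagonal matrix with invertible blocks, as a unit. -/
def blockUnit (d : Fˣ) (B : (Matrix (Fin 2) (Fin 2) F)ˣ) : (Matrix (Fin 3) (Fin 3) F)ˣ where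
  val := blockMat d.1 B.1
  inv := blockMat d⁻¹.1 B⁻¹.1
  val_inv := by rw [blockMat_mul, Units.mul_inv, Units.mul_inv, blockMat_one]
  inv_val := by rw [blockMat_mul, Units.inv_mul, Units.inv_mul, blockMat_one]

end LinearSubstitution

section DicksonInvariants

variable {F : Type u} [Field F]

/-- The alternating form `x y ^ Q - x ^ Q y`. -/
def dicksonForm (F : Type u) [Field F] (Q : ℕ) : MvPolynomial (Fin 3) F :=
  X 1 * X 2 ^ Q - X 1 ^ Q * X 2

/-- The second Dickson invariant of `GL(2, 𝔽_q)`. -/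
def dicksonQuot (F : Type u) [Field F] (q : ℕ) : MvPolynomial (Fin 3) F :=
  ∑ i ∈ Finset.range (q + 1), (X 2 ^ (q - 1)) ^ i * (X 1 ^ (q - 1)) ^ (q - i)

lemma dicksonForm_eq_mul {Q : ℕ} (hQ : 0 < Q) :
    dicksonForm F Q = X 1 * (X 2 ^ Q - X 1 ^ (Q - 1) * X 2) := by
  obtain ⟨Q, rfl⟩ := Nat.exists_eq_succ_of_ne_zero hQ.ne'
  rw [dicksonForm, Nat.succ_eq_add_one, Nat.add_sub_cancel]
  ring

lemma dicksonForm_mul_dicksonQuot {q : ℕ} (hq : 0 < q) :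
    dicksonForm F q * dicksonQuot F q = dicksonForm F (q ^ 2) := by
  obtain ⟨k, rfl⟩ := Nat.exists_eq_succ_of_ne_zero hq.ne'
  have h := geom_sum₂_mul (X 2 ^ k : MvPolynomial (Fin 3) F) (X 1 ^ k) (k + 1 + 1)
  simp only [Nat.add_sub_cancel] at h
  have h1 : dicksonForm F (k + 1) = X 1 * X 2 * (X 2 ^ k - X 1 ^ k) := by
    rw [dicksonForm]; ring
  have h2 : dicksonForm F ((k + 1) ^ 2) =
      X 1 * X 2 * ((X 2 ^ k) ^ (k + 1 + 1) - (X 1 ^ k) ^ (k + 1 + 1)) := by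
    rw [dicksonForm]; ring
  rw [Nat.succ_eq_add_one, h1, h2, ← h, dicksonQuot, Nat.add_sub_cancel]
  ring

lemma dicksonForm_ne_zero {Q : ℕ} (hQ : 1 < Q) : dicksonForm F Q ≠ 0 := by
  classical
  intro h
  have h1 := congrArg (coeff (Finsupp.single 1 1 + Finsupp.single 2 Q)) h
  have h2 : (X 1 * X 2 ^ Q : MvPolynomial (Fin 3) F) =
      monomial (Finsupp.single 1 1 + Finsupp.single 2 Q) 1 := by
    rw [X_pow_eq_monomial, X, monomial_mul, mul_one]
  have h3 : (X 1 ^ Q * X 2 : MvPolynomial (Fin 3) F) =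
      monomial (Finsupp.single 1 Q + Finsupp.single 2 1) 1 := by
    rw [X_pow_eq_monomial, X, monomial_mul, mul_one]
  rw [dicksonForm, h2, h3, coeff_sub, coeff_monomial, coeff_monomial, if_pos rfl, if_neg,
    sub_zero, coeff_zero] at h1
  · exact one_ne_zero h1
  · intro h4
    have h5 := DFunLike.congr_fun h4 1
    simp at h5
    omega

lemma isHomogeneous_dicksonForm (Q : ℕ) : (dicksonForm F Q).IsHomogeneous (Q + 1) := by
  rw [dicksonForm]
  refine IsHomogeneous.sub ?_ ?_
  · rw [add_comm]
    simpa using (isHomogeneous_X F 1).mul ((isHomogeneous_X F (2 : Fin 3)).pow Q)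
  · simpa using ((isHomogeneous_X F (1 : Fin 3)).pow Q).mul (isHomogeneous_X F 2)

lemma isHomogeneous_dicksonQuot (q : ℕ) : (dicksonQuot F q).IsHomogeneous ((q - 1) * q) := by
  refine IsHomogeneous.sum _ _ _ fun i hi => ?_
  have h : (q - 1) * q = 1 * (q - 1) * i + 1 * (q - 1) * (q - i) := by
    rw [← mul_add, one_mul, Nat.add_sub_of_le (Nat.lt_succ_iff.1 (Finset.mem_range.1 hi))]
  rw [h]
  exact ((((isHomogeneous_X F 2).pow _).pow _).mul (((isHomogeneous_X F 1).pow _).pow _))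

lemma X_one_dvd_dicksonQuot_sub {q : ℕ} (hq : 1 < q) :
    (X 1 : MvPolynomial (Fin 3) F) ∣ dicksonQuot F q - X 2 ^ ((q - 1) * q) := by
  rw [dicksonQuot, Finset.sum_range_succ, Nat.sub_self, pow_zero, mul_one, ← pow_mul,
    add_sub_cancel_right]
  refine Finset.dvd_sum fun i hi => Dvd.dvd.mul_left ?_ _
  have := Finset.mem_range.1 hi
  rw [← pow_mul]
  exact dvd_pow_self _ (mul_ne_zero (by omega) (by omega))

variable {p : ℕ} [Fact p.Prime] [CharP F p]

lemma polyAct_dicksonForm (s : ℕ) (c d : F) (A : Matrix (Fin 2) (Fin 2) F)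
    (hA : ∀ i j, A i j ^ p ^ s = A i j) :
    polyAct (blockMat d (c • A)) (dicksonForm F (p ^ s)) =
      (c ^ (p ^ s + 1) * A.det) • dicksonForm F (p ^ s) := by
  have hpow (a b : F) (ha : a ^ p ^ s = a) (hb : b ^ p ^ s = b) :
      ((c * a) • (X 1 : MvPolynomial (Fin 3) F) + (c * b) • X 2) ^ p ^ s =
        c ^ p ^ s • (a • X 1 ^ p ^ s + b • X 2 ^ p ^ s) := by
    rw [add_pow_char_pow, smul_pow, smul_pow, mul_pow, mul_pow, ha, hb, smul_add, smul_smul,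
      smul_smul]
  rw [dicksonForm, map_sub, map_mul, map_mul, map_pow, map_pow, polyAct_blockMat_X_one,
    polyAct_blockMat_X_two]
  simp only [Matrix.smul_apply, smul_eq_mul]
  rw [hpow _ _ (hA 0 0) (hA 0 1), hpow _ _ (hA 1 0) (hA 1 1), Matrix.det_fin_two]
  simp only [smul_eq_C_mul, map_mul, map_sub, map_pow]
  ring

lemma polyAct_dicksonQuot {s : ℕ} (hs : 0 < s) {c : F} (hc : c ≠ 0) (d : F)
    {A : Matrix (Fin 2) (Fin 2) F} (hA : ∀ i j, A i j ^ p ^ s = A i j) (hdet : A.det ≠ 0) :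
    polyAct (blockMat d (c • A)) (dicksonQuot F (p ^ s)) =
      c ^ ((p ^ s - 1) * p ^ s) • dicksonQuot F (p ^ s) := by
  have hq : 1 < p ^ s := Nat.one_lt_pow hs.ne' (Fact.out : p.Prime).one_lt
  have h0 : c ^ (p ^ s + 1) * A.det ≠ 0 := mul_ne_zero (pow_ne_zero _ hc) hdet
  refine mul_left_cancel₀ (smul_ne_zero h0 (dicksonForm_ne_zero (F := F) hq)) ?_
  rw [← polyAct_dicksonForm s c d A hA, ← map_mul, dicksonForm_mul_dicksonQuot (by omega),
    ← pow_mul, polyAct_dicksonForm (s * 2) c d A fun i j => by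
      rw [pow_mul, pow_two, pow_mul, hA, hA], polyAct_dicksonForm s c d A hA, smul_mul_smul_comm,
    dicksonForm_mul_dicksonQuot (by omega), pow_mul]
  congr 1
  have h1 : (p ^ s) ^ 2 + 1 = (p ^ s + 1) + (p ^ s - 1) * p ^ s := by
    obtain ⟨k, hk⟩ := Nat.exists_eq_add_of_lt hq
    rw [hk]
    simp only [Nat.add_sub_cancel]
    ring
  rw [h1, pow_add]
  ring

end DicksonInvariants

section DicksonTheorem

variable {F : Type u} [Field F]

/-- Invariance under the matrices of determinant one with entries fixed by `x ↦ x ^ q`, acting on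
the last two variables. -/
def IsSLInvariant (q : ℕ) (f : MvPolynomial (Fin 3) F) : Prop :=
  ∀ A : Matrix (Fin 2) (Fin 2) F, A.det = 1 → (∀ i j, A i j ^ q = A i j) →
    polyAct (blockMat 1 A) f = f

/-- The product of the translates `y + a x` with `a ^ q = a`. -/
def dicksonNorm (F : Type u) [Field F] (q : ℕ) : MvPolynomial (Fin 3) F :=
  X 2 ^ q - X 1 ^ (q - 1) * X 2

lemma isHomogeneous_dicksonNorm {q : ℕ} (hq : 0 < q) : (dicksonNorm F q).IsHomogeneous q := by
  refine IsHomogeneous.sub ?_ ?_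
  · simpa using (isHomogeneous_X F (2 : Fin 3)).pow q
  · have h : q = 1 * (q - 1) + 1 := by omega
    conv_rhs => rw [h]
    exact ((isHomogeneous_X F 1).pow _).mul (isHomogeneous_X F 2)

lemma not_X_one_dvd_dicksonNorm {q : ℕ} (hq : 1 < q) : ¬ X 1 ∣ dicksonNorm F q := by
  intro h
  have h1 : X 1 ∣ (X 2 ^ q : MvPolynomial (Fin 3) F) := by
    refine (dvd_sub_left (Dvd.dvd.mul_right (dvd_pow_self _ ?_) _)).1 h
    omega
  have h2 := X_dvd_X.1 (X_prime.dvd_of_dvd_pow h1)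
  exact absurd h2 (by decide)

lemma dicksonNorm_ne_zero {q : ℕ} (hq : 1 < q) : dicksonNorm F q ≠ 0 := fun h =>
  not_X_one_dvd_dicksonNorm (F := F) hq (h ▸ dvd_zero _)

lemma isUnit_blockMat {A : Matrix (Fin 2) (Fin 2) F} (hA : A.det = 1) :
    IsUnit (blockMat 1 A) := by
  obtain ⟨U, rfl⟩ := (Matrix.isUnit_iff_isUnit_det A).2 (hA ▸ isUnit_one)
  exact ⟨blockUnit 1 U, rfl⟩

lemma prime_smul_X_one_add_X_two (a : F) :
    Prime (a • X 1 + X 2 : MvPolynomial (Fin 3) F) := by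
  obtain ⟨U, hU⟩ := isUnit_blockMat (A := !![1, 0; a, 1]) (by simp)
  have h : polyActEquiv U (X 2) = (a • X 1 + X 2 : MvPolynomial (Fin 3) F) := by
    change polyAct U.1 (X 2) = _
    simp [hU]
  rw [← h, MulEquiv.prime_iff]
  exact X_prime

lemma isRelPrime_smul_X_one_add_X_two {a b : F} (hab : a ≠ b) :
    IsRelPrime (a • X 1 + X 2 : MvPolynomial (Fin 3) F) (b • X 1 + X 2) := by
  rw [(prime_smul_X_one_add_X_two a).irreducible.isRelPrime_iff_not_dvd]
  intro h
  have h1 := map_dvd (eval ![0, 1, -a]) h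
  simp only [smul_eq_C_mul, map_add, map_mul, eval_C, eval_X] at h1
  simp only [Matrix.cons_val, mul_one, add_neg_cancel, zero_dvd_iff] at h1
  exact hab (add_neg_eq_zero.1 h1).symm

variable {p : ℕ} [Fact p.Prime] [CharP F p] {s : ℕ}

lemma one_lt_card (p : ℕ) [Fact p.Prime] (hs : 0 < s) : 1 < p ^ s :=
  Nat.one_lt_pow hs.ne' (Fact.out : p.Prime).one_lt

lemma polyAct_dicksonNorm (hs : 0 < s) {a : F} (ha : a ^ p ^ s = a) :
    polyAct (blockMat 1 !![1, 0; a, 1]) (dicksonNorm F (p ^ s)) = dicksonNorm F (p ^ s) := by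
  have hq := one_lt_card p hs
  have h := polyAct_dicksonForm (p := p) s 1 1 !![1, 0; a, 1] (by
    intro i j
    fin_cases i <;> fin_cases j <;> simp [ha, (Fact.out : p.Prime).ne_zero])
  rw [dicksonForm_eq_mul (by omega), map_mul] at h
  simp only [one_smul, polyAct_blockMat_X_one, one_pow, Matrix.det_fin_two] at h
  simpa [dicksonNorm] using h

lemma dicksonNorm_dvd (hs : 0 < s) {S : Finset F} (hcard : S.card = p ^ s)
    (hS : ∀ a ∈ S, a ^ p ^ s = a) {g : MvPolynomial (Fin 3) F}
    (hg : ∀ a ∈ S, a • X 1 + X 2 ∣ g) : dicksonNorm F (p ^ s) ∣ g := by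
  have hq := one_lt_card p hs
  have hprod {f : MvPolynomial (Fin 3) F} (hf : ∀ a ∈ S, a • X 1 + X 2 ∣ f) :
      ∏ a ∈ S, (a • X 1 + X 2) ∣ f :=
    Finset.prod_dvd_of_isRelPrime (fun a _ b _ hab => isRelPrime_smul_X_one_add_X_two hab) hf
  obtain ⟨c, hc⟩ := hprod (f := dicksonNorm F (p ^ s)) fun a ha => by
    have h1 : X 2 ∣ dicksonNorm F (p ^ s) :=
      dvd_sub (dvd_pow_self _ (by omega)) (Dvd.intro_left _ rfl)
    have h2 := map_dvd (polyAct (blockMat 1 !![1, 0; a, 1])) h1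
    rw [polyAct_dicksonNorm hs (hS a ha)] at h2
    simpa using h2
  have hne := dicksonNorm_ne_zero (F := F) hq
  rw [hc] at hne
  have h1 := congrArg totalDegree hc
  have h2 : (∏ a ∈ S, (a • X 1 + X 2 : MvPolynomial (Fin 3) F)).IsHomogeneous (p ^ s) := by
    have h3 := IsHomogeneous.prod S (fun a => (a • X 1 + X 2 : MvPolynomial (Fin 3) F))
      (fun _ => 1) fun a _ => by
        rw [smul_eq_C_mul]
        exact ((isHomogeneous_X F 1).C_mul a).add (isHomogeneous_X F 2)
    simpa [hcard] using h3
  rw [totalDegree_mul_of_isDomain (left_ne_zero_of_mul hne) (right_ne_zero_of_mul hne),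
    h2.totalDegree (left_ne_zero_of_mul hne),
    (isHomogeneous_dicksonNorm (by omega)).totalDegree (dicksonNorm_ne_zero hq)] at h1
  have h3 : c = C (c.coeff 0) := totalDegree_eq_zero_iff_eq_C.1 (by omega)
  have h4 : IsUnit c := by
    rw [h3]
    refine IsUnit.map C (isUnit_iff_ne_zero.2 fun h => right_ne_zero_of_mul hne ?_)
    rw [h3, h, C_0]
  rw [hc, h4.mul_right_dvd]
  exact hprod hg

lemma dicksonForm_dvd (hs : 0 < s) {S : Finset F} (hcard : S.card = p ^ s)
    (hS : ∀ a ∈ S, a ^ p ^ s = a) {g : MvPolynomial (Fin 3) F}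
    (hg : IsSLInvariant (p ^ s) g) (hX : X 1 ∣ g) : dicksonForm F (p ^ s) ∣ g := by
  have hq := one_lt_card p hs
  obtain ⟨k, rfl⟩ : dicksonNorm F (p ^ s) ∣ g := by
    refine dicksonNorm_dvd hs hcard hS fun a ha => ?_
    have h1 := map_dvd (polyAct (blockMat 1 !![a, 1; -1, 0])) hX
    rw [hg !![a, 1; -1, 0] (by simp [Matrix.det_fin_two]) (by
      intro i j
      fin_cases i <;> fin_cases j <;>
        simp [hS a ha, neg_one_pow_char_pow, (Fact.out : p.Prime).ne_zero])] at h1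
    simpa using h1
  have h2 := (X_prime.dvd_or_dvd hX).resolve_left (not_X_one_dvd_dicksonNorm hq)
  rw [dicksonForm_eq_mul (by omega), mul_comm]
  exact mul_dvd_mul_left _ h2

lemma dvd_of_coeff_ne_zero_of_unipotent (hs : 0 < s) {S : Finset F} (hcard : S.card = p ^ s)
    (hS : ∀ a ∈ S, a ^ p ^ s = a) {f : MvPolynomial (Fin 3) F}
    (hf : ∀ a ∈ S, polyAct (blockMat 1 !![1, 0; a, 1]) f = f) {m : Fin 3 →₀ ℕ} (hm : m 1 = 0)
    (hfm : f.coeff m ≠ 0) : p ^ s ∣ m 2 := by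
  classical
  have hq := one_lt_card p hs
  induction hd : f.totalDegree using Nat.strong_induction_on generalizing f m with
  | _ d ih =>
  subst hd
  set f₀ := f.modMonomial (Finsupp.single 2 1) with hf₀
  have hle (m : Fin 3 →₀ ℕ) : Finsupp.single 2 1 ≤ m ↔ m 2 ≠ 0 := by
    rw [Finsupp.single_le_iff, Nat.one_le_iff_ne_zero]
  have hcoeff (m : Fin 3 →₀ ℕ) (hm : m 2 ≠ 0) : f₀.coeff m = 0 :=
    coeff_modMonomial_of_le f ((hle m).2 hm)
  have hinv (a : F) : polyAct (blockMat 1 !![1, 0; a, 1]) f₀ = f₀ := by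
    refine hom_congr_vars (f₁ := (polyAct (blockMat 1 !![1, 0; a, 1])).toRingHom)
      (f₂ := RingHom.id _) ?_ (fun i hi _ => ?_) rfl
    · ext1 r
      exact (polyAct (blockMat 1 !![1, 0; a, 1])).commutes r
    · obtain ⟨m, hm, hi⟩ := (mem_vars_iff_mem_support _).1 hi
      change polyAct _ (X i) = X i
      fin_cases i
      · simp
      · simp
      · exact absurd (hcoeff m (Finsupp.mem_support_iff.1 hi)) (mem_support_iff.1 hm)
  have hX : X 2 ∣ f - f₀ := by
    refine ⟨f.divMonomial (Finsupp.single 2 1), ?_⟩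
    rw [sub_eq_iff_eq_add]
    exact (divMonomial_add_modMonomial_single f 2).symm
  obtain ⟨ψ, hψ⟩ : dicksonNorm F (p ^ s) ∣ f - f₀ := by
    refine dicksonNorm_dvd hs hcard hS fun a ha => ?_
    have h1 := map_dvd (polyAct (blockMat 1 !![1, 0; a, 1])) hX
    rw [map_sub, hf a ha, hinv] at h1
    simpa using h1
  by_cases hm2 : m 2 = 0
  · rw [hm2]; exact dvd_zero _
  have hN := dicksonNorm_ne_zero (F := F) hq
  have hψm : (dicksonNorm F (p ^ s) * ψ).coeff m ≠ 0 := by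
    rwa [← hψ, coeff_sub, hcoeff m hm2, sub_zero]
  have hψ0 : ψ ≠ 0 := by rintro rfl; simp at hψm
  have hψinv (a : F) (ha : a ∈ S) : polyAct (blockMat 1 !![1, 0; a, 1]) ψ = ψ := by
    have h1 := congrArg (polyAct (blockMat 1 !![1, 0; a, 1])) hψ
    rw [map_sub, hf a ha, hinv, map_mul, polyAct_dicksonNorm hs (hS a ha), hψ] at h1
    exact (mul_left_cancel₀ hN h1).symm
  have hdeg : ψ.totalDegree < f.totalDegree := by
    have h1 := congrArg totalDegree hψ
    rw [totalDegree_mul_of_isDomain hN hψ0,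
      (isHomogeneous_dicksonNorm (by omega)).totalDegree hN] at h1
    have h2 := totalDegree_sub f f₀
    have h3 : f₀.totalDegree ≤ f.totalDegree := by
      refine totalDegree_le_of_support_subset fun a ha => ?_
      rw [mem_support_iff] at ha ⊢
      by_cases h4 : a 2 = 0
      · rwa [hf₀, coeff_modMonomial_of_not_le f (by rw [hle]; simpa using h4)] at ha
      · exact absurd (hcoeff a h4) ha
    rw [max_eq_left h3] at h2
    omega
  have hsplit : (X 2 ^ p ^ s * ψ).coeff m ≠ 0 := by
    have h1 : (X 1 ^ (p ^ s - 1) * X 2 * ψ).coeff m = 0 :=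
      X_dvd_iff_coeff.1 (((dvd_pow_self _ (by omega)).mul_right _).mul_right _) m hm
    rwa [dicksonNorm, sub_mul, coeff_sub, h1, sub_zero] at hψm
  rw [X_pow_eq_monomial, coeff_monomial_mul', one_mul] at hsplit
  have hle2 : Finsupp.single 2 (p ^ s) ≤ m := by
    by_contra h; exact hsplit (if_neg h)
  rw [if_pos hle2] at hsplit
  have h5 := ih _ hdeg hψinv (by simp [hm]) hsplit rfl
  rw [Finsupp.tsub_apply, Finsupp.single_eq_same] at h5
  exact (Nat.dvd_sub_iff_left (Finsupp.single_le_iff.1 hle2) dvd_rfl).1 h5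

/-- Scaling of the variables by the weights `l`. -/
def scaleHom {n : ℕ} (l : Fin n → F) : MvPolynomial (Fin n) F →ₐ[F] MvPolynomial (Fin n) F :=
  aeval fun i => l i • X i

lemma coeff_scaleHom {n : ℕ} (l : Fin n → F) (f : MvPolynomial (Fin n) F) (m : Fin n →₀ ℕ) :
    (scaleHom l f).coeff m = (∏ i, l i ^ m i) * f.coeff m := by
  classical
  induction f using MvPolynomial.induction_on' with
  | add f g hf hg => rw [map_add, coeff_add, coeff_add, hf, hg, mul_add]
  | monomial a c =>
    have h : scaleHom l (monomial a c) = monomial a ((∏ i, l i ^ a i) * c) := by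
      rw [scaleHom, aeval_monomial, Finsupp.prod_fintype _ _ (by simp)]
      simp_rw [smul_pow, smul_eq_C_mul]
      rw [Finset.prod_mul_distrib, monomial_eq (s := a), Finsupp.prod_fintype _ _ (by simp),
        algebraMap_eq]
      simp only [map_mul, map_prod]
      ring
    rw [h, coeff_monomial, coeff_monomial]
    split_ifs with hm
    · rw [hm]
    · rw [mul_zero]

lemma scaleHom_eq_self_iff {n : ℕ} (l : Fin n → F) (f : MvPolynomial (Fin n) F) :
    scaleHom l f = f ↔ ∀ m, f.coeff m ≠ 0 → ∏ i, l i ^ m i = 1 := by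
  rw [MvPolynomial.ext_iff]
  refine forall_congr' fun m => ?_
  rw [coeff_scaleHom]
  by_cases h : f.coeff m = 0
  · simp [h]
  · simp [h]

lemma sub_one_dvd_of_forall_pow_eq_one {q : ℕ} (hq : 1 < q) {S : Finset F} (hcard : S.card = q)
    {n : ℕ} (hn : ∀ a ∈ S, a ≠ 0 → a ^ n = 1) (hS : ∀ a ∈ S, a ^ q = a) : q - 1 ∣ n := by
  classical
  rw [Nat.dvd_iff_mod_eq_zero]
  by_contra hr
  have hlt : n % (q - 1) < q - 1 := Nat.mod_lt _ (by omega)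
  have hsub : S.erase 0 ⊆ (Polynomial.nthRoots (n % (q - 1)) (1 : F)).toFinset := by
    intro a ha
    obtain ⟨ha0, haS⟩ := Finset.mem_erase.1 ha
    rw [Multiset.mem_toFinset, Polynomial.mem_nthRoots (Nat.pos_of_ne_zero hr)]
    have h1 : a ^ (q - 1) = 1 := by
      refine mul_left_cancel₀ ha0 ?_
      rw [mul_one, ← pow_succ', Nat.sub_add_cancel hq.le, hS a haS]
    have h2 := hn a haS ha0
    rwa [← Nat.mod_add_div n (q - 1), pow_add, pow_mul, h1, one_pow, mul_one] at h2
  have h1 := Finset.card_le_card hsub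
  have h2 := Multiset.toFinset_card_le (Polynomial.nthRoots (n % (q - 1)) (1 : F))
  have h3 := Polynomial.card_nthRoots (n % (q - 1)) (1 : F)
  have h4 := Finset.pred_card_le_card_erase (s := S) (a := 0)
  omega

lemma polyAct_blockMat_diag (d a b : F) :
    polyAct (blockMat d !![a, 0; 0, b]) = scaleHom ![d, a, b] := by
  apply MvPolynomial.algHom_ext
  intro i
  rw [scaleHom, aeval_X]
  fin_cases i <;> simp

lemma IsSLInvariant.dvd_of_coeff_ne_zero (hs : 0 < s) {S : Finset F} (hcard : S.card = p ^ s)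
    (hS : ∀ a ∈ S, a ^ p ^ s = a) {f : MvPolynomial (Fin 3) F} (hf : IsSLInvariant (p ^ s) f)
    {m : Fin 3 →₀ ℕ} (hm : m 1 = 0) (hfm : f.coeff m ≠ 0) : (p ^ s - 1) * p ^ s ∣ m 2 := by
  have hq := one_lt_card p hs
  have hp := (Fact.out : p.Prime).ne_zero
  refine Nat.Coprime.mul_dvd_of_dvd_of_dvd ?_ ?_ ?_
  · exact (Nat.coprime_self_sub_left hq.le).2 (Nat.coprime_one_left _)
  · refine sub_one_dvd_of_forall_pow_eq_one hq hcard (fun a ha ha0 => ?_) hS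
    have h1 := hf !![a⁻¹, 0; 0, a] (by simp [ha0]) (by
      intro i j
      fin_cases i <;> fin_cases j <;> simp [hS a ha, hp])
    rw [polyAct_blockMat_diag, scaleHom_eq_self_iff] at h1
    simpa [Fin.prod_univ_three, hm] using h1 m hfm
  · refine dvd_of_coeff_ne_zero_of_unipotent hs hcard hS (fun a ha => ?_) hm hfm
    refine hf _ (by simp) fun i j => ?_
    fin_cases i <;> fin_cases j <;> simp [hS a ha, hp]

end DicksonTheorem

section DicksonHom

variable {F : Type u} [Field F]

/-- The homomorphism from a polynomial ring onto the ring generated by the first variable and the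
two Dickson invariants. -/
def dicksonHom (F : Type u) [Field F] (q : ℕ) :
    MvPolynomial (Fin 3) F →ₐ[F] MvPolynomial (Fin 3) F :=
  aeval ![X 0, dicksonForm F q, dicksonQuot F q]

@[simp] lemma dicksonHom_X_zero (q : ℕ) : dicksonHom F q (X 0) = X 0 := aeval_X _ _

@[simp] lemma dicksonHom_X_one (q : ℕ) : dicksonHom F q (X 1) = dicksonForm F q := aeval_X _ _

@[simp] lemma dicksonHom_X_two (q : ℕ) : dicksonHom F q (X 2) = dicksonQuot F q := aeval_X _ _

/-- Substitution of zero for the middle variable. -/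
def killMiddle (F : Type u) [Field F] : MvPolynomial (Fin 3) F →ₐ[F] MvPolynomial (Fin 3) F :=
  aeval ![X 0, 0, X 2]

lemma killMiddle_eq_zero_of_dvd {f : MvPolynomial (Fin 3) F} (h : X 1 ∣ f) :
    killMiddle F f = 0 := by
  obtain ⟨g, rfl⟩ := h
  rw [map_mul, killMiddle, aeval_X]
  exact zero_mul _

lemma killMiddle_dicksonHom {q : ℕ} (hq : 1 < q) (g : MvPolynomial (Fin 3) F) :
    killMiddle F (dicksonHom F q g) = aeval ![X 0, 0, X 2 ^ ((q - 1) * q)] g := by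
  rw [← AlgHom.comp_apply]
  congr 1
  apply MvPolynomial.algHom_ext
  intro i
  rw [AlgHom.comp_apply, aeval_X]
  fin_cases i
  · simp [killMiddle]
  · refine (congrArg _ (dicksonHom_X_one q)).trans (killMiddle_eq_zero_of_dvd ?_)
    rw [dicksonForm_eq_mul (by omega)]
    exact dvd_mul_right _ _
  · refine (congrArg _ (dicksonHom_X_two q)).trans ?_
    have h := killMiddle_eq_zero_of_dvd (X_one_dvd_dicksonQuot_sub (F := F) hq)
    rw [map_sub, sub_eq_zero] at h
    rw [h]
    simp [killMiddle]

lemma coeff_aeval_killMiddle_pow {Q : ℕ} (hQ : 0 < Q) (g : MvPolynomial (Fin 3) F)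
    {m : Fin 3 →₀ ℕ} (hm : m 1 = 0) :
    (aeval ![X 0, 0, X 2 ^ Q] g : MvPolynomial (Fin 3) F).coeff
      (Finsupp.single 0 (m 0) + Finsupp.single 2 (Q * m 2)) = g.coeff m := by
  classical
  induction g using MvPolynomial.induction_on' with
  | add f g hf hg => rw [map_add, coeff_add, coeff_add, hf, hg]
  | monomial a c =>
    rw [aeval_monomial, Finsupp.prod_fintype _ _ (by simp), Fin.prod_univ_three, algebraMap_eq]
    simp only [Matrix.cons_val]
    by_cases ha : a 1 = 0
    · rw [ha, pow_zero, mul_one, ← pow_mul, X_pow_eq_monomial, X_pow_eq_monomial, monomial_mul,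
        C_mul_monomial, coeff_monomial, coeff_monomial]
      have h1 : Finsupp.single (0 : Fin 3) (a 0) + Finsupp.single 2 (Q * a 2) =
          Finsupp.single (0 : Fin 3) (m 0) + Finsupp.single 2 (Q * m 2) ↔ a = m := by
        constructor
        · intro h
          have h0 := DFunLike.congr_fun h 0
          have h2 := DFunLike.congr_fun h 2
          simp [hQ.ne'] at h0 h2
          ext i
          fin_cases i
          exacts [h0, ha.trans hm.symm, h2]
        · rintro rfl; rfl
      simp only [mul_one]
      exact if_congr h1 rfl rfl
    · rw [zero_pow ha, coeff_monomial, if_neg (by rintro rfl; exact ha hm)]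
      simp

lemma dicksonHom_injective {q : ℕ} (hq : 1 < q) : Function.Injective (dicksonHom F q) := by
  rw [injective_iff_map_eq_zero]
  intro g hg
  induction hd : g.totalDegree using Nat.strong_induction_on generalizing g with
  | _ d ih =>
  subst hd
  have hX : X 1 ∣ g := by
    rw [X_dvd_iff_coeff]
    intro m hm
    rw [← coeff_aeval_killMiddle_pow (Q := (q - 1) * q) (Nat.mul_pos (by omega) (by omega)) g hm,
      ← killMiddle_dicksonHom hq, hg, map_zero (killMiddle F), coeff_zero]
  obtain ⟨k, rfl⟩ := hX
  by_contra hne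
  have hk := right_ne_zero_of_mul hne
  rw [map_mul, dicksonHom_X_one] at hg
  refine hk (ih _ ?_ k ((mul_eq_zero.1 hg).resolve_left (dicksonForm_ne_zero hq)) rfl)
  rw [totalDegree_mul_of_isDomain (X_ne_zero _) hk, totalDegree_X]
  omega

variable {p : ℕ} [Fact p.Prime] [CharP F p] {s : ℕ}

lemma isSLInvariant_dicksonHom (hs : 0 < s) (g : MvPolynomial (Fin 3) F) :
    IsSLInvariant (p ^ s) (dicksonHom F (p ^ s) g) := by
  intro A hdet hA
  rw [← AlgHom.comp_apply]
  congr 1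
  apply MvPolynomial.algHom_ext
  intro i
  rw [AlgHom.comp_apply]
  fin_cases i
  · simp
  · have h := polyAct_dicksonForm (p := p) s 1 1 A hA
    simpa [hdet] using h
  · have h := polyAct_dicksonQuot (p := p) hs one_ne_zero 1 hA (hdet ▸ one_ne_zero)
    simpa using h

/-- Every polynomial invariant under `SL(2, 𝔽_q)` is a polynomial in the Dickson invariants. -/
theorem IsSLInvariant.exists_dicksonHom_eq (hs : 0 < s) {S : Finset F} (hcard : S.card = p ^ s)
    (hS : ∀ a ∈ S, a ^ p ^ s = a) {f : MvPolynomial (Fin 3) F} (hf : IsSLInvariant (p ^ s) f) :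
    ∃ g, dicksonHom F (p ^ s) g = f := by
  classical
  have hq := one_lt_card p hs
  induction hd : f.totalDegree using Nat.strong_induction_on generalizing f with
  | _ d ih =>
  subst hd
  set Q := (p ^ s - 1) * p ^ s with hQ
  have hdvd (m : Fin 3 →₀ ℕ) (hm : m ∈ f.support.filter (· 1 = 0)) : Q ∣ m 2 :=
    hf.dvd_of_coeff_ne_zero hs hcard hS (Finset.mem_filter.1 hm).2
      (mem_support_iff.1 (Finset.mem_filter.1 hm).1)
  let g₀ : MvPolynomial (Fin 3) F :=
    ∑ m ∈ f.support.filter (· 1 = 0), C (f.coeff m) * (X 0 ^ m 0 * X 2 ^ (m 2 / Q))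
  have hg₀ : dicksonHom F (p ^ s) g₀ =
      ∑ m ∈ f.support.filter (· 1 = 0),
        C (f.coeff m) * (X 0 ^ m 0 * dicksonQuot F (p ^ s) ^ (m 2 / Q)) := by
    simp only [g₀, map_sum, map_mul, map_pow, dicksonHom_X_zero, dicksonHom_X_two]
    simp only [← algebraMap_eq, AlgHom.commutes]
  have hdeg₀ : (dicksonHom F (p ^ s) g₀).totalDegree ≤ f.totalDegree := by
    rw [hg₀]
    refine totalDegree_finsetSum_le fun m hm => ?_
    have h1 : (m.sum fun _ e => e) ≤ f.totalDegree := le_totalDegree (Finset.mem_filter.1 hm).1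
    rw [Finsupp.sum_fintype _ _ (by simp), Fin.sum_univ_three] at h1
    have h2 : (C (f.coeff m) * (X 0 ^ m 0 * dicksonQuot F (p ^ s) ^ (m 2 / Q))).IsHomogeneous
        (1 * m 0 + Q * (m 2 / Q)) :=
      (((isHomogeneous_X F 0).pow _).mul ((isHomogeneous_dicksonQuot _).pow _)).C_mul _
    have h3 := h2.totalDegree_le
    rw [Nat.mul_div_cancel' (hdvd m hm)] at h3
    omega
  have hX : X 1 ∣ f - dicksonHom F (p ^ s) g₀ := by
    have h1 : X 1 ∣ f - ∑ m ∈ f.support.filter (· 1 = 0),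
        C (f.coeff m) * (X 0 ^ m 0 * (X 2 ^ Q) ^ (m 2 / Q)) := by
      rw [X_dvd_iff_coeff]
      intro m hm
      have h2 (a : Fin 3 →₀ ℕ) (ha : a ∈ f.support.filter (· 1 = 0)) :
          C (f.coeff a) * (X 0 ^ a 0 * (X 2 ^ Q) ^ (a 2 / Q)) = monomial a (f.coeff a) := by
        rw [← pow_mul, Nat.mul_div_cancel' (hdvd a ha), monomial_eq,
          Finsupp.prod_fintype _ _ (by simp), Fin.prod_univ_three, (Finset.mem_filter.1 ha).2,
          pow_zero, mul_one]
      rw [Finset.sum_congr rfl h2, coeff_sub, coeff_sum]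
      simp_rw [coeff_monomial]
      rw [Finset.sum_ite_eq']
      split_ifs with h3
      · exact sub_self _
      · rw [sub_zero]
        by_contra h4
        exact h3 (Finset.mem_filter.2 ⟨mem_support_iff.2 h4, hm⟩)
    have h5 : X 1 ∣ (∑ m ∈ f.support.filter (· 1 = 0),
        C (f.coeff m) * (X 0 ^ m 0 * (X 2 ^ Q) ^ (m 2 / Q))) - dicksonHom F (p ^ s) g₀ := by
      rw [hg₀, ← Finset.sum_sub_distrib]
      refine Finset.dvd_sum fun m _ => ?_
      rw [← mul_sub, ← mul_sub]
      refine ((Dvd.dvd.trans ?_ (sub_dvd_pow_sub_pow _ _ _)).mul_left _).mul_left _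
      rw [dvd_sub_comm]
      exact X_one_dvd_dicksonQuot_sub hq
    simpa using dvd_add h1 h5
  have hinv : IsSLInvariant (p ^ s) (f - dicksonHom F (p ^ s) g₀) := fun A hdet hA => by
    rw [map_sub, hf A hdet hA, isSLInvariant_dicksonHom hs g₀ A hdet hA]
  obtain ⟨k, hk⟩ := dicksonForm_dvd hs hcard hS hinv hX
  have hL := dicksonForm_ne_zero (F := F) hq
  rcases eq_or_ne k 0 with rfl | hk0
  · exact ⟨g₀, by rwa [mul_zero, sub_eq_zero, eq_comm] at hk⟩
  have hkinv : IsSLInvariant (p ^ s) k := by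
    intro A hdet hA
    have h := hinv A hdet hA
    have h1 := polyAct_dicksonForm (p := p) s 1 1 A hA
    simp only [one_smul, one_pow, one_mul, hdet] at h1
    rw [hk, map_mul, h1] at h
    exact mul_left_cancel₀ hL h
  have hdeg : k.totalDegree < f.totalDegree := by
    have h1 := totalDegree_sub f (dicksonHom F (p ^ s) g₀)
    rw [hk, totalDegree_mul_of_isDomain hL hk0,
      (isHomogeneous_dicksonForm (F := F) (p ^ s)).totalDegree hL, max_eq_left hdeg₀] at h1
    omega
  obtain ⟨g', hg'⟩ := ih _ hdeg hkinv rfl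
  refine ⟨g₀ + X 1 * g', ?_⟩
  rw [map_add, map_mul, dicksonHom_X_one, hg', ← hk]
  exact add_sub_cancel _ _

end DicksonHom

section FrobeniusFixed

variable {F : Type u} [Field F] (p : ℕ) [Fact p.Prime] [CharP F p] (s : ℕ)

/-- The subfield of elements fixed by the `s`-th power of Frobenius. -/
def frobeniusFixed (F : Type u) [Field F] (p : ℕ) [Fact p.Prime] [CharP F p] (s : ℕ) :
    Subfield F :=
  (iterateFrobenius F p s).eqLocusField (RingHom.id F)

variable {p s}

lemma mem_frobeniusFixed {x : F} : x ∈ frobeniusFixed F p s ↔ x ^ p ^ s = x := Iff.rfl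

/-- A matrix conjugating `SL(2, 𝔽_q)` into matrices over `𝔽_q` is a scalar multiple of a matrix
over `𝔽_q`. -/
lemma exists_eq_smul_of_conj {B B' : Matrix (Fin 2) (Fin 2) F} (hB : B * B' = 1)
    (h : ∀ A : Matrix (Fin 2) (Fin 2) F, A.det = 1 → (∀ i j, A i j ^ p ^ s = A i j) →
      ∀ i j, (B * A * B') i j ^ p ^ s = (B * A * B') i j) :
    ∃ (c : F) (A : Matrix (Fin 2) (Fin 2) F), c ≠ 0 ∧ A.det ≠ 0 ∧
      (∀ i j, A i j ^ p ^ s = A i j) ∧ B = c • A := by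
  simp_rw [← mem_frobeniusFixed] at h ⊢
  have hB' : B' * B = 1 := mul_eq_one_comm.1 hB
  have hmem (E : Matrix (Fin 2) (Fin 2) F) (hdet : (1 + E).det = 1)
      (hE : ∀ i j, (1 + E) i j ∈ frobeniusFixed F p s) (i j : Fin 2) :
      (B * E * B') i j ∈ frobeniusFixed F p s := by
    have h1 := h _ hdet hE i j
    rw [mul_add, add_mul, mul_one, hB, Matrix.add_apply] at h1
    refine (add_mem_cancel_left ?_).1 h1
    rw [Matrix.one_apply]
    split_ifs
    exacts [one_mem _, zero_mem _]
  have h01 (i j : Fin 2) : B i 0 * B' 1 j ∈ frobeniusFixed F p s := by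
    have h1 := hmem !![0, 1; 0, 0] (by simp [Matrix.det_fin_two]) (fun i j => by
      fin_cases i <;> fin_cases j <;> simp [one_mem, zero_mem]) i j
    simpa [Matrix.mul_apply, Fin.sum_univ_two] using h1
  have h10 (i j : Fin 2) : B i 1 * B' 0 j ∈ frobeniusFixed F p s := by
    have h1 := hmem !![0, 0; 1, 0] (by simp [Matrix.det_fin_two]) (fun i j => by
      fin_cases i <;> fin_cases j <;> simp [one_mem, zero_mem]) i j
    simpa [Matrix.mul_apply, Fin.sum_univ_two] using h1
  have hone (i : Fin 2) : B' i 0 * B 0 i + B' i 1 * B 1 i = 1 := by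
    rw [← Fin.sum_univ_two (fun k => B' i k * B k i), ← Matrix.mul_apply, hB', Matrix.one_apply_eq]
  have hall (i k l j : Fin 2) : B i k * B' l j ∈ frobeniusFixed F p s := by
    fin_cases k <;> fin_cases l
    · have h1 : B i 0 * B' 0 j =
          (B i 0 * B' 1 0) * (B 0 1 * B' 0 j) + (B i 0 * B' 1 1) * (B 1 1 * B' 0 j) := by
        linear_combination -(B i 0 * B' 0 j) * hone 1
      exact h1 ▸ add_mem (mul_mem (h01 _ _) (h10 _ _)) (mul_mem (h01 _ _) (h10 _ _))
    · exact h01 i j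
    · exact h10 i j
    · have h1 : B i 1 * B' 1 j =
          (B i 1 * B' 0 0) * (B 0 0 * B' 1 j) + (B i 1 * B' 0 1) * (B 1 0 * B' 1 j) := by
        linear_combination -(B i 1 * B' 1 j) * hone 0
      exact h1 ▸ add_mem (mul_mem (h10 _ _) (h01 _ _)) (mul_mem (h10 _ _) (h01 _ _))
  obtain ⟨l, j, hlj⟩ : ∃ l j, B' l j ≠ 0 := by
    by_contra! h1
    have h2 : B' = 0 := Matrix.ext h1
    rw [h2, mul_zero] at hB
    exact zero_ne_one hB
  refine ⟨(B' l j)⁻¹, B' l j • B, inv_ne_zero hlj, ?_, fun i k => ?_, ?_⟩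
  · rw [Matrix.det_smul]
    exact mul_ne_zero (pow_ne_zero _ hlj) (Matrix.det_ne_zero_of_right_inverse hB)
  · rw [Matrix.smul_apply, smul_eq_mul, mul_comm]
    exact hall i k l j
  · rw [smul_smul, inv_mul_cancel₀ hlj, one_smul]

end FrobeniusFixed

section BlockSubgroup

variable {F : Type u} [Field F]

/-- All elements of the subgroup are block diagonal with blocks of size `1` and `2`. -/
def IsBlockSubgroup (G : Subgroup (Matrix.SpecialLinearGroup (Fin 3) F)) : Prop :=
  ∀ g ∈ G, (g : Matrix (Fin 3) (Fin 3) F) 0 1 = 0 ∧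
    (g : Matrix (Fin 3) (Fin 3) F) 0 2 = 0 ∧ (g : Matrix (Fin 3) (Fin 3) F) 1 0 = 0 ∧
    (g : Matrix (Fin 3) (Fin 3) F) 2 0 = 0

lemma blockMat_injective {d d' : F} {B B' : Matrix (Fin 2) (Fin 2) F}
    (h : blockMat d B = blockMat d' B') : d = d' ∧ B = B' := by
  have h1 (i j : Fin 3) : blockMat d B i j = blockMat d' B' i j := by rw [h]
  refine ⟨by simpa [blockMat] using h1 0 0, ?_⟩
  ext i j
  fin_cases i <;> fin_cases j
  · simpa [blockMat] using h1 1 1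
  · simpa [blockMat] using h1 1 2
  · simpa [blockMat] using h1 2 1
  · simpa [blockMat] using h1 2 2

variable {G : Subgroup (Matrix.SpecialLinearGroup (Fin 3) F)}

lemma IsBlockSubgroup.coe_eq (hG : IsBlockSubgroup G) {g : Matrix.SpecialLinearGroup (Fin 3) F}
    (hg : g ∈ G) : (g : Matrix (Fin 3) (Fin 3) F) = blockMat (g 0 0) (subW g) := by
  obtain ⟨h1, h2, h3, h4⟩ := hG g hg
  ext i j
  fin_cases i <;> fin_cases j <;> simp [blockMat, subW, h1, h2, h3, h4]

lemma IsBlockSubgroup.apply_subW_mul (hG : IsBlockSubgroup G) (g h : G) :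
    (g * h).1 0 0 = g.1 0 0 * h.1 0 0 ∧ subW (g * h).1 = subW g.1 * subW h.1 := by
  apply blockMat_injective
  rw [← hG.coe_eq (g * h).2, ← blockMat_mul, ← hG.coe_eq g.2, ← hG.coe_eq h.2]
  rfl

/-- The action of a block subgroup on the line. -/
def IsBlockSubgroup.cornerHom (hG : IsBlockSubgroup G) : G →* F where
  toFun g := g.1 0 0
  map_one' := by simp
  map_mul' g h := (hG.apply_subW_mul g h).1

/-- The action of a block subgroup on the plane, with respect to a given basis. -/
def IsBlockSubgroup.restrictHom (hG : IsBlockSubgroup G) (P : (Matrix (Fin 2) (Fin 2) F)ˣ) :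
    G →* Matrix (Fin 2) (Fin 2) F where
  toFun g := restrictW P g
  map_one' := by
    have h : subW (1 : Matrix.SpecialLinearGroup (Fin 3) F) = 1 := by
      ext i j
      fin_cases i <;> fin_cases j <;> simp [subW]
    simp [restrictW, h]
  map_mul' g h := by
    rw [restrictW, restrictW, restrictW, (hG.apply_subW_mul g h).2]
    simp only [mul_assoc, Units.mul_inv_cancel_left]

lemma IsBlockSubgroup.apply_mul_det_restrictW (hG : IsBlockSubgroup G)
    (P : (Matrix (Fin 2) (Fin 2) F)ˣ) {g : Matrix.SpecialLinearGroup (Fin 3) F} (hg : g ∈ G) :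
    g 0 0 * (restrictW P g).det = 1 := by
  have h1 := g.2
  rw [hG.coe_eq hg] at h1
  rw [restrictW, Matrix.det_units_conj']
  refine Eq.trans ?_ h1
  rw [Matrix.det_fin_three, Matrix.det_fin_two]
  simp [blockMat]
  ring

lemma IsBlockSubgroup.mul_blockUnit (hG : IsBlockSubgroup G) (P : (Matrix (Fin 2) (Fin 2) F)ˣ)
    {g : Matrix.SpecialLinearGroup (Fin 3) F} (hg : g ∈ G) :
    (g : Matrix (Fin 3) (Fin 3) F) * (blockUnit 1 P).1 =
      (blockUnit 1 P).1 * blockMat (g 0 0) (restrictW P g) := by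
  rw [hG.coe_eq hg, blockUnit]
  dsimp only
  rw [blockMat_mul, blockMat_mul, restrictW, mul_assoc, Units.mul_inv_cancel_left,
    Units.val_one, one_mul, mul_one]
  rfl

lemma IsBlockSubgroup.transSubgroup_le (hG : IsBlockSubgroup G) :
    transSubgroup G ≤ hG.cornerHom.ker.map G.subtype := by
  refine (Subgroup.closure_le _).2 fun τ hτ => ?_
  obtain ⟨hτG, -, h0⟩ := hτ
  refine ⟨⟨τ, hτG⟩, MonoidHom.mem_ker.2 ?_, rfl⟩
  change τ 0 0 = 1
  have h1 := congrFun (congrFun h0 0) 0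
  obtain ⟨h01, h02, h10, h20⟩ := hG τ hτG
  simp [Matrix.mul_apply, Fin.sum_univ_three, h01, h02] at h1
  exact sub_eq_zero.1 h1

lemma conj_mem_transSubgroup {g τ : Matrix.SpecialLinearGroup (Fin 3) F} (hg : g ∈ G)
    (hτ : τ ∈ transSubgroup G) : g * τ * g⁻¹ ∈ transSubgroup G := by
  suffices h : transSubgroup G ≤ (transSubgroup G).comap (MulAut.conj g).toMonoidHom from h hτ
  refine (Subgroup.closure_le _).2 fun τ hτ => Subgroup.subset_closure ?_
  refine ⟨mul_mem (mul_mem hg hτ.1) (inv_mem hg), ?_⟩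
  obtain ⟨-, h1, h2⟩ := hτ
  have hinv : (g⁻¹).1 * g.1 = 1 := congrArg Subtype.val (inv_mul_cancel g)
  have hinv' : g.1 * (g⁻¹).1 = 1 := congrArg Subtype.val (mul_inv_cancel g)
  have h3 : (g * τ * g⁻¹).1 - 1 = g.1 * (τ.1 - 1) * (g⁻¹).1 := by
    rw [mul_sub, sub_mul, mul_one, hinv']
    rfl
  change ((g * τ * g⁻¹).1 - 1).rank = 1 ∧ ((g * τ * g⁻¹).1 - 1) * ((g * τ * g⁻¹).1 - 1) = 0
  rw [h3]
  constructor
  · rw [Matrix.rank_mul_eq_left_of_isUnit_det _ _ (by rw [(g⁻¹).2]; exact isUnit_one),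
      Matrix.rank_mul_eq_right_of_isUnit_det _ _ (by rw [g.2]; exact isUnit_one), h1]
  · calc g.1 * (τ.1 - 1) * (g⁻¹).1 * (g.1 * (τ.1 - 1) * (g⁻¹).1) =
          g.1 * (τ.1 - 1) * ((g⁻¹).1 * g.1) * (τ.1 - 1) * (g⁻¹).1 := by simp only [mul_assoc]
      _ = g.1 * ((τ.1 - 1) * (τ.1 - 1)) * (g⁻¹).1 := by
        rw [hinv, mul_one]; simp only [mul_assoc]
      _ = 0 := by rw [h2, mul_zero, zero_mul]

/-- The transvections in a block subgroup generate `SL(2, 𝔽_q)` on the plane. -/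
def GeneratesSL (G : Subgroup (Matrix.SpecialLinearGroup (Fin 3) F))
    (P : (Matrix (Fin 2) (Fin 2) F)ˣ) (q : ℕ) : Prop :=
  {M : Matrix (Fin 2) (Fin 2) F | ∃ τ ∈ transSubgroup G, restrictW P τ = M} =
    {M : Matrix (Fin 2) (Fin 2) F | M.det = 1 ∧ ∀ i j, (M i j) ^ q = M i j}

variable {p : ℕ} [Fact p.Prime] [CharP F p] {s : ℕ} {P : (Matrix (Fin 2) (Fin 2) F)ˣ}

lemma IsBlockSubgroup.exists_restrictW_eq_smul (hG : IsBlockSubgroup G)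
    (hT : GeneratesSL G P (p ^ s)) {g : Matrix.SpecialLinearGroup (Fin 3) F} (hg : g ∈ G) :
    ∃ (c : F) (A : Matrix (Fin 2) (Fin 2) F), c ≠ 0 ∧ A.det ≠ 0 ∧
      (∀ i j, A i j ^ p ^ s = A i j) ∧ restrictW P g = c • A := by
  have hmul (a b : G) : restrictW P (a * b : G).1 = restrictW P a.1 * restrictW P b.1 :=
    map_mul (hG.restrictHom P) a b
  refine exists_eq_smul_of_conj (B' := restrictW P g⁻¹) ?_ fun A hdet hA => ?_
  · have h := hmul ⟨g, hg⟩ ⟨g, hg⟩⁻¹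
    rw [mul_inv_cancel] at h
    exact h.symm.trans (map_one (hG.restrictHom P))
  · obtain ⟨τ, hτ, rfl⟩ := hT.ge ⟨hdet, hA⟩
    obtain ⟨⟨τ, hτG⟩, -, rfl⟩ := hG.transSubgroup_le hτ
    have h1 := hmul (⟨g, hg⟩ * ⟨τ, hτG⟩) ⟨g, hg⟩⁻¹
    rw [hmul ⟨g, hg⟩ ⟨τ, hτG⟩] at h1
    have h2 : restrictW P (g * τ * g⁻¹) = restrictW P g * restrictW P τ * restrictW P g⁻¹ := h1
    exact h2 ▸ (hT.le ⟨_, conj_mem_transSubgroup hg hτ, rfl⟩).2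

lemma mem_invariantRing_iff (hG : IsBlockSubgroup G) {f : MvPolynomial (Fin 3) F} :
    f ∈ invariantRing G ↔ ∀ g ∈ G, polyAct (blockMat (g 0 0) (restrictW P g))
      (polyActEquiv (blockUnit 1 P) f) = polyActEquiv (blockUnit 1 P) f := by
  have h1 : f ∈ invariantRing G ↔
      ∀ g ∈ G, polyAct (g : Matrix (Fin 3) (Fin 3) F) f = f :=
    ⟨fun h g hg => h _ ⟨g, hg, rfl⟩, fun h M ⟨g, hg, hM⟩ => hM ▸ h g hg⟩
  rw [h1]
  refine forall₂_congr fun g hg => ?_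
  have h2 (f) : polyActEquiv (blockUnit 1 P) f = polyAct (blockUnit 1 P).1 f := rfl
  rw [h2, polyAct_polyAct, ← hG.mul_blockUnit P hg, ← polyAct_polyAct, ← h2, ← h2,
    (polyActEquiv (blockUnit 1 P)).injective.eq_iff]

lemma IsBlockSubgroup.isSLInvariant (hG : IsBlockSubgroup G) {q : ℕ} (hT : GeneratesSL G P q)
    {f : MvPolynomial (Fin 3) F} (hf : f ∈ invariantRing G) :
    IsSLInvariant q (polyActEquiv (blockUnit 1 P) f) := by
  intro A hdet hA
  obtain ⟨τ, hτ, rfl⟩ := hT.ge ⟨hdet, hA⟩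
  obtain ⟨⟨τ, hτG⟩, h1, rfl⟩ := hG.transSubgroup_le hτ
  have h2 := (mem_invariantRing_iff (P := P) hG).1 hf τ hτG
  rwa [show τ 0 0 = 1 from h1] at h2

end BlockSubgroup

section WeightMonoid

variable {F : Type u} [Field F] {n : ℕ}

/-- The exponents of the monomials fixed by a set of diagonal substitutions. -/
def weightMonoid (L : Set (Fin n → F)) : AddSubmonoid (Fin n →₀ ℕ) where
  carrier := {m | ∀ l ∈ L, ∏ i, l i ^ m i = 1}
  zero_mem' l _ := by simp
  add_mem' ha hb l hl := by
    simp [pow_add, Finset.prod_mul_distrib, ha l hl, hb l hl]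

lemma mem_weightMonoid {L : Set (Fin n → F)} {m : Fin n →₀ ℕ} :
    m ∈ weightMonoid L ↔ ∀ l ∈ L, ∏ i, l i ^ m i = 1 := Iff.rfl

lemma isExponentMonoid_weightMonoid {L : Set (Fin n → F)} {h : ℕ} (hpos : 0 < h)
    (hL : ∀ l ∈ L, ∀ i, l i ^ h = 1) : IsExponentMonoid (weightMonoid L) h where
  pos := hpos
  of_add a b ha hab l hl := by
    simpa [pow_add, Finset.prod_mul_distrib, ha l hl] using hab l hl
  single_mem j l hl := by
    rw [Finset.prod_eq_single j (fun i _ hi => by simp [hi.symm]) (by simp),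
      Finsupp.single_eq_same, hL l hl]

lemma mem_monomialSubalgebra_weightMonoid {L : Set (Fin n → F)} {f : MvPolynomial (Fin n) F} :
    f ∈ monomialSubalgebra F (weightMonoid L) ↔ ∀ l ∈ L, scaleHom l f = f := by
  simp_rw [mem_monomialSubalgebra, scaleHom_eq_self_iff, mem_weightMonoid]
  exact ⟨fun h l hl m hm => h m hm l hl, fun h m hm l hl => h l hl m hm⟩

end WeightMonoid

section InvariantRing

variable {F : Type u} [Field F]

/-- The weights with which a block subgroup acts on the first variable and the Dickson
invariants. -/
def dicksonWeights (G : Subgroup (Matrix.SpecialLinearGroup (Fin 3) F))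
    (P : (Matrix (Fin 2) (Fin 2) F)ˣ) (q : ℕ) : Set (Fin 3 → F) :=
  {l | ∃ g ∈ G, ∃ (c : F) (A : Matrix (Fin 2) (Fin 2) F), c ≠ 0 ∧ A.det ≠ 0 ∧
    (∀ i j, A i j ^ q = A i j) ∧ restrictW P g = c • A ∧
      l = ![g 0 0, c ^ (q + 1) * A.det, c ^ ((q - 1) * q)]}

variable {G : Subgroup (Matrix.SpecialLinearGroup (Fin 3) F)} {P : (Matrix (Fin 2) (Fin 2) F)ˣ}

variable {p : ℕ} [Fact p.Prime] {s : ℕ}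

lemma pow_sub_one_eq_one {a : F} (ha : a ≠ 0) (h : a ^ p ^ s = a) :
    a ^ (p ^ s - 1) = 1 := by
  refine mul_right_cancel₀ ha ?_
  rw [← pow_succ, Nat.sub_add_cancel (Nat.pos_of_ne_zero
    (pow_ne_zero _ (Fact.out : p.Prime).ne_zero)), h, one_mul]

lemma IsBlockSubgroup.mem_weightMonoid_iff (hG : IsBlockSubgroup G) (hs : 0 < s)
    (m : Fin 3 →₀ ℕ) (hm : m 0 = m 1) :
    m ∈ weightMonoid (dicksonWeights G P (p ^ s)) ↔ ∀ g ∈ G, ∀ (c : F)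
      (A : Matrix (Fin 2) (Fin 2) F), c ≠ 0 → A.det ≠ 0 → (∀ i j, A i j ^ p ^ s = A i j) →
        restrictW P g = c • A → c ^ ((p ^ s - 1) * (m 1 + p ^ s * m 2)) = 1 := by
  have hq := one_lt_card p hs
  have key (g : Matrix.SpecialLinearGroup (Fin 3) F) (hg : g ∈ G) (c : F)
      (A : Matrix (Fin 2) (Fin 2) F) (hB : restrictW P g = c • A) :
      ∏ i, ![g 0 0, c ^ (p ^ s + 1) * A.det, c ^ ((p ^ s - 1) * p ^ s)] i ^ m i =
        c ^ ((p ^ s - 1) * (m 1 + p ^ s * m 2)) := by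
    have h1 : g 0 0 * (c ^ (p ^ s + 1) * A.det) = c ^ (p ^ s - 1) := by
      have h2 := hG.apply_mul_det_restrictW P hg
      rw [hB, Matrix.det_smul, Fintype.card_fin] at h2
      have h3 : p ^ s + 1 = p ^ s - 1 + 2 := by omega
      rw [h3, pow_add]
      linear_combination c ^ (p ^ s - 1) * h2
    rw [Fin.prod_univ_three]
    simp only [Matrix.cons_val]
    rw [hm, ← mul_pow, h1, ← pow_mul, ← pow_mul, ← pow_add]
    ring_nf
  rw [mem_weightMonoid]
  constructor
  · intro h g hg c A hc hdet hA hB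
    rw [← key g hg c A hB]
    exact h _ ⟨g, hg, c, A, hc, hdet, hA, hB, rfl⟩
  · rintro h _ ⟨g, hg, c, A, hc, hdet, hA, hB, rfl⟩
    rw [key g hg c A hB]
    exact h g hg c A hc hdet hA hB

variable [CharP F p]

lemma polyAct_dicksonHom (hs : 0 < s) {c : F} (hc : c ≠ 0) (d : F)
    {A : Matrix (Fin 2) (Fin 2) F} (hdet : A.det ≠ 0) (hA : ∀ i j, A i j ^ p ^ s = A i j)
    (g : MvPolynomial (Fin 3) F) :
    polyAct (blockMat d (c • A)) (dicksonHom F (p ^ s) g) = dicksonHom F (p ^ s)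
      (scaleHom ![d, c ^ (p ^ s + 1) * A.det, c ^ ((p ^ s - 1) * p ^ s)] g) := by
  let l : Fin 3 → F := ![d, c ^ (p ^ s + 1) * A.det, c ^ ((p ^ s - 1) * p ^ s)]
  suffices h : (polyAct (blockMat d (c • A))).comp (dicksonHom F (p ^ s)) =
      (dicksonHom F (p ^ s)).comp (scaleHom l) from DFunLike.congr_fun h g
  apply MvPolynomial.algHom_ext
  intro i
  rw [AlgHom.comp_apply, AlgHom.comp_apply, scaleHom, aeval_X, map_smul]
  fin_cases i
  · exact (congrArg _ (dicksonHom_X_zero _)).trans (by simp [l])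
  · exact (congrArg _ (dicksonHom_X_one _)).trans
      ((polyAct_dicksonForm s c d A hA).trans (by simp [l]))
  · exact (congrArg _ (dicksonHom_X_two _)).trans
      ((polyAct_dicksonQuot hs hc d hA hdet).trans (by simp [l]))

lemma map_monomialSubalgebra_dicksonWeights (hs : 0 < s) {S : Finset F} (hcard : S.card = p ^ s)
    (hS : ∀ a ∈ S, a ^ p ^ s = a) (hG : IsBlockSubgroup G) (hT : GeneratesSL G P (p ^ s)) :
    (monomialSubalgebra F (weightMonoid (dicksonWeights G P (p ^ s)))).map
      ((polyActEquiv (blockUnit 1 P)).symm.toAlgHom.comp (dicksonHom F (p ^ s))) =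
      invariantRing G := by
  have hinj := dicksonHom_injective (F := F) (one_lt_card p hs)
  have hiff (g : MvPolynomial (Fin 3) F) :
      (polyActEquiv (blockUnit 1 P)).symm (dicksonHom F (p ^ s) g) ∈ invariantRing G ↔
        g ∈ monomialSubalgebra F (weightMonoid (dicksonWeights G P (p ^ s))) := by
    rw [mem_invariantRing_iff (P := P) hG, AlgEquiv.apply_symm_apply,
      mem_monomialSubalgebra_weightMonoid]
    constructor
    · rintro h l ⟨g', hg', c, A, hc, hdet, hA, hB, rfl⟩
      have h1 := h g' hg'
      rw [hB, polyAct_dicksonHom hs hc _ hdet hA] at h1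
      exact hinj h1
    · intro h g' hg'
      obtain ⟨c, A, hc, hdet, hA, hB⟩ := hG.exists_restrictW_eq_smul hT hg'
      rw [hB, polyAct_dicksonHom hs hc _ hdet hA, h _ ⟨g', hg', c, A, hc, hdet, hA, hB, rfl⟩]
  ext f
  rw [Subalgebra.mem_map]
  constructor
  · rintro ⟨g, hg, rfl⟩
    exact (hiff g).2 hg
  · intro hf
    obtain ⟨g, hg⟩ := (hG.isSLInvariant hT hf).exists_dicksonHom_eq hs hcard hS
    have h1 : (polyActEquiv (blockUnit 1 P)).symm (dicksonHom F (p ^ s) g) = f := by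
      rw [hg, AlgEquiv.symm_apply_apply]
    exact ⟨g, (hiff g).1 (h1 ▸ hf), h1⟩

lemma isGorensteinRing_invariantRing_iff (hs : 0 < s) {S : Finset F} (hcard : S.card = p ^ s)
    (hS : ∀ a ∈ S, a ^ p ^ s = a) (hG : IsBlockSubgroup G) (hT : GeneratesSL G P (p ^ s)) :
    IsGorensteinRing (invariantRing G) ↔
      IsGorensteinRing (monomialSubalgebra F (weightMonoid (dicksonWeights G P (p ^ s)))) := by
  have hinj : Function.Injective
      ((polyActEquiv (blockUnit 1 P)).symm.toAlgHom.comp (dicksonHom F (p ^ s))) :=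
    (polyActEquiv (blockUnit 1 P)).symm.injective.comp (dicksonHom_injective (one_lt_card p hs))
  let e := (monomialSubalgebra F (weightMonoid (dicksonWeights G P (p ^ s)))).equivMapOfInjective
    _ hinj
  rw [map_monomialSubalgebra_dicksonWeights hs hcard hS hG hT] at e
  exact ⟨fun h => h.of_ringEquiv e.symm.toRingEquiv, fun h => h.of_ringEquiv e.toRingEquiv⟩

lemma det_pow_eq {A : Matrix (Fin 2) (Fin 2) F} (hA : ∀ i j, A i j ^ p ^ s = A i j) :
    A.det ^ p ^ s = A.det := by
  rw [← mem_frobeniusFixed, Matrix.det_fin_two]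
  exact sub_mem (mul_mem (hA 0 0) (hA 1 1)) (mul_mem (hA 0 1) (hA 1 0))

/-- There is a common exponent, prime to the characteristic, for all scalars and determinants
occurring in the restriction of a finite block subgroup to the plane. -/
lemma IsBlockSubgroup.exists_exponent [Finite G] (hG : IsBlockSubgroup G) (hs : 0 < s) :
    ∃ h : ℕ, 0 < h ∧ p.Coprime h ∧ ∀ g ∈ G, ∀ (c : F) (A : Matrix (Fin 2) (Fin 2) F), A.det ≠ 0 →
      (∀ i j, A i j ^ p ^ s = A i j) → restrictW P g = c • A → c ^ h = 1 ∧ A.det ^ h = 1 := by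
  have hp : p.Prime := Fact.out
  have hq := one_lt_card p hs
  set N := 2 * Nat.card G * (p ^ s - 1) with hN
  have hN0 : N ≠ 0 := mul_ne_zero (mul_ne_zero two_ne_zero Nat.card_pos.ne') (by omega)
  obtain ⟨k, h, hph, hkh⟩ := Nat.exists_eq_pow_mul_and_not_dvd hN0 p hp.ne_one
  have hred {x : F} (hx : x ^ N = 1) : x ^ h = 1 := by
    rwa [hkh, ExpChar.pow_prime_pow_mul_eq_one_iff] at hx
  refine ⟨h, Nat.pos_of_ne_zero ?_, (hp.coprime_iff_not_dvd).2 hph,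
    fun g hg c A hdet hA hB => ?_⟩
  · rintro rfl
    exact hph (dvd_zero p)
  · have ha := pow_sub_one_eq_one hdet (det_pow_eq hA)
    have hB1 : (c ^ 2 * A.det) ^ Nat.card G = 1 := by
      have h1 : (restrictW P g).det = c ^ 2 * A.det := by
        rw [hB, Matrix.det_smul, Fintype.card_fin]
      have h2 : restrictW P g ^ Nat.card G = 1 := by
        have h3 := map_pow (hG.restrictHom P) ⟨g, hg⟩ (Nat.card G)
        rw [pow_card_eq_one', map_one] at h3
        exact h3.symm
      rw [← h1, ← Matrix.det_pow, h2, Matrix.det_one]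
    refine ⟨hred ?_, hred ?_⟩
    · calc c ^ N = c ^ N * (A.det ^ (p ^ s - 1)) ^ Nat.card G := by rw [ha, one_pow, mul_one]
        _ = ((c ^ 2 * A.det) ^ Nat.card G) ^ (p ^ s - 1) := by rw [hN]; ring
        _ = 1 := by rw [hB1, one_pow]
    · rw [hN, mul_comm, pow_mul, ha, one_pow]

lemma exists_dvd_one_add_mul {q h : ℕ} (hh : 0 < h) (hqh : q.Coprime h) :
    ∃ k, h ∣ 1 + q * k := by
  have : NeZero h := ⟨hh.ne'⟩
  refine ⟨(-(q : ZMod h)⁻¹).val, ?_⟩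
  rw [← ZMod.natCast_eq_zero_iff]
  push_cast
  rw [ZMod.natCast_zmod_val, mul_neg, ZMod.coe_mul_inv_eq_one q hqh, add_neg_cancel]

lemma IsBlockSubgroup.one_mem_weightMonoid_iff (hG : IsBlockSubgroup G) (hs : 0 < s)
    (hT : GeneratesSL G P (p ^ s)) :
    Finsupp.equivFunOnFinite.symm (fun _ => 1) ∈ weightMonoid (dicksonWeights G P (p ^ s)) ↔
      ∀ g ∈ G, ∀ i j : Fin 2, (restrictW P g i j) ^ (p ^ s) ^ 2 = restrictW P g i j := by
  have hq := one_lt_card p hs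
  rw [hG.mem_weightMonoid_iff hs _ rfl]
  have hexp : (p ^ s) ^ 2 = (p ^ s - 1) * (1 + p ^ s * 1) + 1 := by
    obtain ⟨k, hk⟩ := Nat.exists_eq_add_of_lt hq
    rw [hk, Nat.add_sub_cancel]
    ring
  have hA2 {A : Matrix (Fin 2) (Fin 2) F} (hA : ∀ i j, A i j ^ p ^ s = A i j) (i j : Fin 2) :
      A i j ^ (p ^ s) ^ 2 = A i j := by rw [sq, pow_mul, hA, hA]
  constructor
  · intro h g hg i j
    obtain ⟨c, A, hc, hdet, hA, hB⟩ := hG.exists_restrictW_eq_smul hT hg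
    rw [hB, Matrix.smul_apply, smul_eq_mul, mul_pow, hA2 hA, hexp, pow_succ]
    have h1 : c ^ ((p ^ s - 1) * (1 + p ^ s * 1)) = 1 := h g hg c A hc hdet hA hB
    rw [h1, one_mul]
  · intro h g hg c A hc hdet hA hB
    obtain ⟨i, j, hij⟩ : ∃ i j, A i j ≠ 0 := by
      by_contra! h1
      exact hdet (by rw [Matrix.ext (N := 0) h1, Matrix.det_zero])
    have h1 := h g hg i j
    rw [hB, Matrix.smul_apply, smul_eq_mul, mul_pow, hA2 hA, hexp, pow_succ] at h1
    exact mul_right_cancel₀ hc ((mul_right_cancel₀ hij h1).trans (one_mul c).symm)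

end InvariantRing

/-- Chapter A, case `T(G)|W = SL(2, 𝔽_q)`: `S(V)^G` is Gorenstein iff
`G|W ⊆ GL(2, 𝔽_{q²})`, i.e. all entries `x` of the matrices `g|W` satisfy `x^{q²} = x`. -/
theorem stmt4 (p : ℕ) [Fact p.Prime] (F : Type u) [Field F] [CharP F p]
    (s : ℕ) (hs : 0 < s)
    (hFq : ∃ S : Finset F, S.card = p ^ s ∧ ∀ x ∈ S, x ^ (p ^ s) = x)
    (G : Subgroup (Matrix.SpecialLinearGroup (Fin 3) F)) [Finite G]
    (hblock : ∀ g ∈ G, (g : Matrix (Fin 3) (Fin 3) F) 0 1 = 0 ∧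
      (g : Matrix (Fin 3) (Fin 3) F) 0 2 = 0 ∧ (g : Matrix (Fin 3) (Fin 3) F) 1 0 = 0 ∧
      (g : Matrix (Fin 3) (Fin 3) F) 2 0 = 0)
    (P : (Matrix (Fin 2) (Fin 2) F)ˣ)
    (hTW : {M : Matrix (Fin 2) (Fin 2) F | ∃ τ ∈ transSubgroup G, restrictW P τ = M} =
      {M : Matrix (Fin 2) (Fin 2) F | M.det = 1 ∧ ∀ i j, (M i j) ^ (p ^ s) = M i j}) :
    IsGorensteinRing ↥(invariantRing G) ↔
      ∀ g ∈ G, ∀ i j : Fin 2, (restrictW P g i j) ^ (p ^ s) ^ 2 = restrictW P g i j := by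
  obtain ⟨S, hcard, hS⟩ := hFq
  have hG : IsBlockSubgroup G := hblock
  have hT : GeneratesSL G P (p ^ s) := hTW
  obtain ⟨h, hpos, hcop, hh⟩ := hG.exists_exponent (P := P) hs
  have hcop' : (p ^ s).Coprime h := hcop.pow_left s
  have hpow {c : F} (hc : c ^ h = 1) {k : ℕ} (hk : h ∣ k) : c ^ ((p ^ s - 1) * k) = 1 := by
    obtain ⟨r, rfl⟩ := hk
    rw [mul_left_comm, pow_mul, hc, one_pow]
  have hM : IsExponentMonoid (weightMonoid (dicksonWeights G P (p ^ s))) h := by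
    refine isExponentMonoid_weightMonoid hpos ?_
    rintro _ ⟨g, hg, c, A, hc, hdet, hA, hB, rfl⟩ i
    obtain ⟨hc1, ha1⟩ := hh g hg c A hdet hA hB
    fin_cases i
    · change g 0 0 ^ h = 1
      have h1 := congrArg (· ^ h) (hG.apply_mul_det_restrictW P hg)
      rw [hB, Matrix.det_smul, Fintype.card_fin] at h1
      simpa [mul_pow, ha1, pow_right_comm c 2 h, hc1] using h1
    · change (c ^ (p ^ s + 1) * A.det) ^ h = 1
      rw [mul_pow, ha1, mul_one, pow_right_comm, hc1, one_pow]
    · change (c ^ ((p ^ s - 1) * p ^ s)) ^ h = 1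
      rw [pow_right_comm, hc1, one_pow]
  have hone (j : Fin 3) : ∃ m ∈ weightMonoid (dicksonWeights G P (p ^ s)), m j = 1 := by
    have hmem (a b : ℕ) (hab : h ∣ a + p ^ s * b) :
        Finsupp.equivFunOnFinite.symm ![a, a, b] ∈
          weightMonoid (dicksonWeights G P (p ^ s)) :=
      (hG.mem_weightMonoid_iff hs _ rfl).2 fun g hg c A _ hdet hA hB =>
        hpow (hh g hg c A hdet hA hB).1 hab
    obtain ⟨k, hk⟩ := exists_dvd_one_add_mul hpos hcop'
    fin_cases j
    · exact ⟨_, hmem 1 k hk, rfl⟩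
    · exact ⟨_, hmem 1 k hk, rfl⟩
    · refine ⟨_, hmem (p ^ s * (h - 1)) 1 ?_, rfl⟩
      rw [← mul_add, Nat.sub_add_cancel hpos]
      exact dvd_mul_left _ _
  rw [isGorensteinRing_invariantRing_iff hs hcard hS hG hT, ← hG.one_mem_weightMonoid_iff hs hT]
  exact ⟨fun hGor => hGor.one_mem hM hone, isGorensteinRing_monomialSubalgebra hM⟩

end
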